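/- Let M be a finite dimensional indecomposable H_{mn}(ξ)-module of (s,t)-type. If s < t, then t = s + 1; if s > t, then s = t + 1. Consequently, every finite dimensional indecomposable H_{mn}(ξ)-module of Loewy length 2 is of (s,s)-type, of (s,s+1)-type, or of (s+1,s)-type for some integer s ≥ 1. -/

import Mathlib

noncomputable section

namespace Radford

variable (𝕜 : Type) [Field 𝕜]

/-- The q-integer `(k)_q = 1 + q + ⋯ + q^(k-1)`. -/
def qInt (q : 𝕜) (k : ℕ) : 𝕜 := ∑ j ∈ Finset.range k, q ^ j

/-- The q-factorial `(k)!_q = (1)_q (2)_q ⋯ (k)_q`. -/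
def qFact (q : 𝕜) : ℕ → 𝕜
  | 0 => 1
  | k + 1 => qFact q k * qInt 𝕜 q (k + 1)

variable (m n : ℕ) (ξ : 𝕜)

/-- Generators of the free algebra: 0 ↦ a, 1 ↦ b, 2 ↦ c, 3 ↦ d. -/
def fgen (k : Fin 4) : FreeAlgebra 𝕜 (Fin 4) := FreeAlgebra.ι 𝕜 k

local notation "fa" => fgen 𝕜 0
local notation "fb" => fgen 𝕜 1
local notation "fc" => fgen 𝕜 2
local notation "fd" => fgen 𝕜 3

/-- The defining relations of the Drinfeld double `H_{mn}(ξ) = D(R_{mn}(q))`, where `q = ξ^m`. -/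
inductive HRel : FreeAlgebra 𝕜 (Fin 4) → FreeAlgebra 𝕜 (Fin 4) → Prop
  | aPow : HRel (fa ^ n) (fb ^ n - 1)
  | bPow : HRel (fb ^ (m * n)) 1
  | cPow : HRel (fc ^ (m * n)) 1
  | dPow : HRel (fd ^ n) 0
  | ab : HRel (fa * fb) (ξ ^ m • (fb * fa))
  | dc : HRel (fd * fc) (ξ • (fc * fd))
  | bc : HRel (fb * fc) (fc * fb)
  | bd : HRel (fb * fd) (ξ ^ m • (fd * fb))
  | ad : HRel (fa * fd - fd * fa) (fb - fc ^ m)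
  | ac : HRel (fa * fc)
      (ξ⁻¹ • (fc * fa) +
        ((ξ⁻¹ - ξ ^ (n - 1)) / qFact 𝕜 (ξ ^ m) (n - 1)) •
          ((fc ^ (m + 1) - ξ ^ m • (fb * fc)) * fd ^ (n - 1)))

/-- The Drinfeld double `H_{mn}(ξ)` of the Radford Hopf algebra `R_{mn}(q)`, presented by
generators `a, b, c, d` and the above relations. -/
def H := RingQuot (HRel 𝕜 m n ξ)

instance : Ring (H 𝕜 m n ξ) := inferInstanceAs (Ring (RingQuot (HRel 𝕜 m n ξ)))

instance : Algebra 𝕜 (H 𝕜 m n ξ) := inferInstanceAs (Algebra 𝕜 (RingQuot (HRel 𝕜 m n ξ)))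

/-- The generators `a, b, c, d` of `H_{mn}(ξ)` (indexed by 0,1,2,3). -/
def gen (k : Fin 4) : H 𝕜 m n ξ := RingQuot.mkAlgHom 𝕜 (HRel 𝕜 m n ξ) (fgen 𝕜 k)

local notation "ha" => gen 𝕜 m n ξ 0
local notation "hb" => gen 𝕜 m n ξ 1
local notation "hc" => gen 𝕜 m n ξ 2
local notation "hd" => gen 𝕜 m n ξ 3

/-- The Jacobson radical `J` of `H_{mn}(ξ)`. -/
def jrad : Ideal (H 𝕜 m n ξ) := Ideal.jacobson ⊥

/-- The scalars `α_k(l,i)`;  `alph l i k` is `α_k(l,i)`, where `q = ξ^m`. -/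
def alph (l : ℕ) (i : ℤ) (k : ℕ) : 𝕜 :=
  if k = n then ((ξ ^ m) ^ (i + (l : ℤ)) - (ξ ^ m) ^ i) / qFact 𝕜 (ξ ^ m) (n - 1)
  else qInt 𝕜 (ξ ^ m) k * ((ξ ^ m) ^ i - (ξ ^ m) ^ (i + (l : ℤ) - (k : ℤ)))

/-- The scalars `γ_k(l,i)`;  `gam l i k` is `γ_k(l,i)`, where `q = ξ^m`. -/
def gam (l : ℕ) (i : ℤ) (k : ℕ) : 𝕜 :=
  if k = n then ((ξ ^ m) ^ i - (ξ ^ m) ^ (i + (l : ℤ))) / qFact 𝕜 (ξ ^ m) (n - 1)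
  else qInt 𝕜 (ξ ^ m) k * ((ξ ^ m) ^ (i + (l : ℤ)) - (ξ ^ m) ^ (i - (k : ℤ)))

section ModuleH

variable {W : Type} [AddCommGroup W] [Module (H 𝕜 m n ξ) W]

variable (W) in
/-- The socle of an `H`-module: the sum of all simple submodules. -/
def socle : Submodule (H 𝕜 m n ξ) W :=
  sSup {N : Submodule (H 𝕜 m n ξ) W | IsSimpleModule (H 𝕜 m n ξ) N}

variable (W) in
/-- The submodule `J•W`, the radical of `W`. -/
def radM : Submodule (H 𝕜 m n ξ) W :=
  Submodule.span (H 𝕜 m n ξ) {x | ∃ r ∈ jrad 𝕜 m n ξ, ∃ w : W, x = r • w}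

variable (W) in
/-- The submodule `J²•W`. -/
def rad2M : Submodule (H 𝕜 m n ξ) W :=
  Submodule.span (H 𝕜 m n ξ)
    {x | ∃ r ∈ jrad 𝕜 m n ξ, ∃ s ∈ jrad 𝕜 m n ξ, ∃ w : W, x = r • s • w}

variable (W) in
/-- The submodule `J³•W`. -/
def rad3M : Submodule (H 𝕜 m n ξ) W :=
  Submodule.span (H 𝕜 m n ξ)
    {x | ∃ r ∈ jrad 𝕜 m n ξ, ∃ s ∈ jrad 𝕜 m n ξ, ∃ t ∈ jrad 𝕜 m n ξ, ∃ w : W, x = r • s • t • w}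

variable (W) in
/-- `lengthIs c W` : the `H`-module `W` has a composition series of length `c`
(hence, by Jordan–Hölder, has composition length `c`). -/
def lengthIs (c : ℕ) : Prop :=
  ∃ s : CompositionSeries (Submodule (H 𝕜 m n ξ) W), s.head = ⊥ ∧ s.last = ⊤ ∧ s.length = c

variable (W) in
/-- An `H`-module is indecomposable if it is nonzero and is not the direct sum of two
nonzero submodules. -/
def Indec : Prop :=
  Nontrivial W ∧ ∀ N₁ N₂ : Submodule (H 𝕜 m n ξ) W, IsCompl N₁ N₂ → N₁ = ⊥ ∨ N₂ = ⊥

variable (W) in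
/-- `W` has Loewy length 2: `J•W ≠ 0` and `J²•W = 0`. -/
def LoewyLen2 : Prop := radM 𝕜 m n ξ W ≠ ⊥ ∧ rad2M 𝕜 m n ξ W = ⊥

variable (W) in
/-- `W` is of `(s,t)`-type: it has Loewy length `2`, its socle has composition length `t`,
and `W/soc W` has composition length `s`. -/
def IsType (s t : ℕ) : Prop :=
  LoewyLen2 𝕜 m n ξ W ∧ lengthIs 𝕜 m n ξ (socle 𝕜 m n ξ W) t ∧
    lengthIs 𝕜 m n ξ (W ⧸ socle 𝕜 m n ξ W) s

end ModuleH

section ModuleK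

variable {V : Type} [AddCommGroup V] [Module 𝕜 V] [Module (H 𝕜 m n ξ) V]
  [IsScalarTower 𝕜 (H 𝕜 m n ξ) V]

variable (V) in
/-- `V^d = {v ∈ V | d•v = 0}`, as a `𝕜`-subspace. -/
def dKer : Submodule 𝕜 V where
  carrier := {v | hd • v = 0}
  add_mem' := by
    intro x y hx hy
    simp only [Set.mem_setOf_eq] at *
    rw [smul_add, hx, hy, add_zero]
  zero_mem' := smul_zero _
  smul_mem' := by
    intro r v hv
    simp only [Set.mem_setOf_eq] at *
    rw [smul_comm, hv, smul_zero]

variable (V) in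
/-- `V_{(i)} = {v ∈ V | c•v = ξ^i v}`, as a `𝕜`-subspace. -/
def eigsp (i : ℤ) : Submodule 𝕜 V where
  carrier := {v | hc • v = ξ ^ i • v}
  add_mem' := by
    intro x y hx hy
    simp only [Set.mem_setOf_eq] at *
    rw [smul_add, hx, hy, smul_add]
  zero_mem' := by simp
  smul_mem' := by
    intro r v hv
    simp only [Set.mem_setOf_eq] at *
    rw [smul_comm, hv, smul_comm]

/-- `V`, equipped with the family `mv : Fin l → V`, realizes the simple module `M(l,i)`:
`mv` is a basis of `V` and the generators act by the defining formulas of `M(l,i)`. -/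
def IsMrep (l : ℕ) (i : ℤ) (mv : Fin l → V) : Prop :=
  LinearIndependent 𝕜 mv ∧ Submodule.span 𝕜 (Set.range mv) = ⊤ ∧
  (∀ (j : ℕ) (hj : j + 1 < l),
    ha • mv ⟨j, by omega⟩ = alph 𝕜 m n ξ l i (j + 1) • mv ⟨j + 1, hj⟩) ∧
  (∀ (j : ℕ) (hj : j < l), j + 1 = l → ha • mv ⟨j, hj⟩ = 0) ∧
  (∀ j : Fin l, hb • mv j = ((ξ ^ m) ^ (i + (l : ℤ) - ((j : ℕ) + 1 : ℤ)) : 𝕜) • mv j) ∧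
  (∀ j : Fin l, hc • mv j = (ξ ^ (i + (j : ℕ) : ℤ) : 𝕜) • mv j) ∧
  (∀ (j : ℕ) (hj : j + 1 < l), hd • mv ⟨j + 1, hj⟩ = mv ⟨j, by omega⟩) ∧
  (∀ hl : 0 < l, hd • mv ⟨0, hl⟩ = 0)

/-- `V` realizes the induced module `Z(λ_{ij})`: there is a cyclic vector `z` with
`d•z = 0`, `b•z = ξ^j z`, `c•z = ξ^i z` such that `(a^k • z)_{0 ≤ k ≤ n-1}` is a basis. -/
def IsZrep (i j : ℤ) (V : Type) [AddCommGroup V] [Module 𝕜 V] [Module (H 𝕜 m n ξ) V]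
    [IsScalarTower 𝕜 (H 𝕜 m n ξ) V] : Prop :=
  ∃ z : V, hd • z = 0 ∧ hb • z = (ξ ^ j : 𝕜) • z ∧ hc • z = (ξ ^ i : 𝕜) • z ∧
    LinearIndependent 𝕜 (fun k : Fin n => (ha ^ (k : ℕ)) • z) ∧
    Submodule.span 𝕜 (Set.range fun k : Fin n => (ha ^ (k : ℕ)) • z) = ⊤

/-- `V`, equipped with the families `v u : Fin n → V`, realizes the projective module `P(l,i)`
with its standard basis. -/
def IsPrep (l : ℕ) (hl1 : 1 ≤ l) (hl2 : l < n) (i : ℤ) (v u : Fin n → V) : Prop :=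
  LinearIndependent 𝕜 (Sum.elim v u) ∧
  Submodule.span 𝕜 (Set.range v ∪ Set.range u) = ⊤ ∧
  (∀ (j : ℕ) (hj : j + l + 2 ≤ n),
    ha • v ⟨j, by omega⟩ = gam 𝕜 m n ξ l i (j + 1) • v ⟨j + 1, by omega⟩) ∧
  (∀ (j : ℕ) (hj : j + 1 < n), n ≤ j + 1 + l →
    ha • v ⟨j, by omega⟩ =
      gam 𝕜 m n ξ l i (j + 1) • v ⟨j + 1, hj⟩ + u ⟨j + 1 + l - n, by omega⟩) ∧
  (ha • v ⟨n - 1, by omega⟩ = gam 𝕜 m n ξ l i n • v ⟨0, by omega⟩ + u ⟨l, by omega⟩) ∧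
  (∀ (j : ℕ) (hj : j + 1 < n),
    ha • u ⟨j, by omega⟩ = alph 𝕜 m n ξ l i (j + 1) • u ⟨j + 1, hj⟩) ∧
  (ha • u ⟨n - 1, by omega⟩ = alph 𝕜 m n ξ l i n • u ⟨0, by omega⟩) ∧
  (∀ j : Fin n, hb • v j = ((ξ ^ m) ^ (i + (n : ℤ) - ((j : ℕ) + 1 : ℤ)) : 𝕜) • v j) ∧
  (∀ j : Fin n, hb • u j = ((ξ ^ m) ^ (i + (l : ℤ) - ((j : ℕ) + 1 : ℤ)) : 𝕜) • u j) ∧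
  (∀ j : Fin n, hc • v j = (ξ ^ (i - ((n : ℤ) - (l : ℤ)) + (j : ℕ) : ℤ) : 𝕜) • v j) ∧
  (∀ j : Fin n, hc • u j = (ξ ^ (i + (j : ℕ) : ℤ) : 𝕜) • u j) ∧
  (hd • v ⟨0, by omega⟩ = 0) ∧
  (∀ (j : ℕ) (hj : j + 1 < n), hd • v ⟨j + 1, hj⟩ = v ⟨j, by omega⟩) ∧
  (hd • u ⟨0, by omega⟩ = 0) ∧
  (∀ (j : ℕ) (hj : j + 1 < n), hd • u ⟨j + 1, hj⟩ = u ⟨j, by omega⟩)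

/-- `V`, equipped with the basis `e : Fin n → V`, realizes the module `T_1(l,i)`. -/
def IsT1rep (l : ℕ) (hl1 : 1 ≤ l) (hl2 : l < n) (i : ℤ) (e : Fin n → V) : Prop :=
  LinearIndependent 𝕜 e ∧ Submodule.span 𝕜 (Set.range e) = ⊤ ∧
  (∀ (j : ℕ) (hj : j + 1 < n),
    ha • e ⟨j, by omega⟩ = alph 𝕜 m n ξ l i (j + 1) • e ⟨j + 1, hj⟩) ∧
  (ha • e ⟨n - 1, by omega⟩ = alph 𝕜 m n ξ l i n • e ⟨0, by omega⟩) ∧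
  (∀ j : Fin n, hb • e j = ((ξ ^ m) ^ (i + (l : ℤ) - ((j : ℕ) + 1 : ℤ)) : 𝕜) • e j) ∧
  (∀ j : Fin n, hc • e j = (ξ ^ (i + (j : ℕ) : ℤ) : 𝕜) • e j) ∧
  (hd • e ⟨0, by omega⟩ = 0) ∧
  (∀ (j : ℕ) (hj : j + 1 < n), hd • e ⟨j + 1, hj⟩ = e ⟨j, by omega⟩)

/-- `V`, equipped with the basis `e : Fin n → V`, realizes the module `T̄_1(l,i)`. -/
def IsT1barrep (l : ℕ) (hl1 : 1 ≤ l) (hl2 : l < n) (i : ℤ) (e : Fin n → V) : Prop :=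
  LinearIndependent 𝕜 e ∧ Submodule.span 𝕜 (Set.range e) = ⊤ ∧
  (∀ (j : ℕ) (hj : j + 1 < n - l),
    ha • e ⟨j, by omega⟩ = alph 𝕜 m n ξ (n - l) (i + l - n) (j + 1) • e ⟨j + 1, by omega⟩) ∧
  (ha • e ⟨n - l - 1, by omega⟩ = e ⟨n - l, by omega⟩) ∧
  (∀ (k : ℕ) (hk : k + 1 < l),
    ha • e ⟨n - l + k, by omega⟩ = alph 𝕜 m n ξ l i (k + 1) • e ⟨n - l + k + 1, by omega⟩) ∧
  (ha • e ⟨n - 1, by omega⟩ = 0) ∧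
  (∀ j : Fin n, hb • e j = ((ξ ^ m) ^ (i - ((j : ℕ) + 1 : ℤ)) : 𝕜) • e j) ∧
  (∀ j : Fin n, hc • e j = (ξ ^ (i + (l : ℤ) - (n : ℤ) + (j : ℕ) : ℤ) : 𝕜) • e j) ∧
  (hd • e ⟨0, by omega⟩ = 0) ∧
  (∀ (j : ℕ) (hj : j + 1 < n - l), hd • e ⟨j + 1, by omega⟩ = e ⟨j, by omega⟩) ∧
  (hd • e ⟨n - l, by omega⟩ = 0) ∧
  (∀ (k : ℕ) (hk : k + 1 < l), hd • e ⟨n - l + k + 1, by omega⟩ = e ⟨n - l + k, by omega⟩)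

end ModuleK

section Matrices

/-- The nilpotent Jordan-type matrix `D_s` with `1` on the superdiagonal. -/
def Dmat (s : ℕ) : Matrix (Fin s) (Fin s) 𝕜 :=
  fun r c => if (r : ℕ) + 1 = (c : ℕ) then 1 else 0

/-- The matrix `X_{l,i}` : subdiagonal entries `γ_k(l,i)`, `(1,n)`-entry `γ_n(l,i)`. -/
def Xmat (l : ℕ) (i : ℤ) : Matrix (Fin n) (Fin n) 𝕜 := fun r c =>
  if (r : ℕ) = (c : ℕ) + 1 then gam 𝕜 m n ξ l i ((c : ℕ) + 1)
  else if (r : ℕ) = 0 ∧ (c : ℕ) = n - 1 then gam 𝕜 m n ξ l i n else 0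

/-- The matrix `Z_{l,i}` : subdiagonal entries `α_k(l,i)`, `(1,n)`-entry `α_n(l,i)`. -/
def Zmat (l : ℕ) (i : ℤ) : Matrix (Fin n) (Fin n) 𝕜 := fun r c =>
  if (r : ℕ) = (c : ℕ) + 1 then alph 𝕜 m n ξ l i ((c : ℕ) + 1)
  else if (r : ℕ) = 0 ∧ (c : ℕ) = n - 1 then alph 𝕜 m n ξ l i n else 0

/-- The block matrix `A(l,i) = [[X_{l,i}, 0], [D_n^{n-l-1}, Z_{l,i}]]`. -/
def Amat (l : ℕ) (i : ℤ) : Matrix (Fin n ⊕ Fin n) (Fin n ⊕ Fin n) 𝕜 :=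
  Matrix.fromBlocks (Xmat 𝕜 m n ξ l i) 0 (Dmat 𝕜 n ^ (n - l - 1)) (Zmat 𝕜 m n ξ l i)

/-- The diagonal matrix `B(l,i)`. -/
def Bmat (l : ℕ) (i : ℤ) : Matrix (Fin n ⊕ Fin n) (Fin n ⊕ Fin n) 𝕜 :=
  Matrix.fromBlocks
    (Matrix.diagonal fun j : Fin n => (ξ ^ m) ^ (i - ((j : ℕ) + 1 : ℤ))) 0 0
    (Matrix.diagonal fun j : Fin n => (ξ ^ m) ^ (i + (l : ℤ) - ((j : ℕ) + 1 : ℤ)))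

/-- The diagonal matrix `C(l,i)`. -/
def Cmat (l : ℕ) (i : ℤ) : Matrix (Fin n ⊕ Fin n) (Fin n ⊕ Fin n) 𝕜 :=
  Matrix.fromBlocks
    (Matrix.diagonal fun j : Fin n => ξ ^ (i + (l : ℤ) - (n : ℤ) + (j : ℕ))) 0 0
    (Matrix.diagonal fun j : Fin n => ξ ^ (i + (j : ℕ) : ℤ))

/-- The block matrix `D = diag(D_n, D_n)`. -/
def Dbig : Matrix (Fin n ⊕ Fin n) (Fin n ⊕ Fin n) 𝕜 :=
  Matrix.fromBlocks (Dmat 𝕜 n) 0 0 (Dmat 𝕜 n)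

end Matrices

end Radford

namespace Radford
section Pairs

variable {K : Type} [Field K] {ι : Type} [Fintype ι]

/-- A complete family of orthogonal projections of a vector space. -/
structure IsProjFamily {U : Type} [AddCommGroup U] [Module K U]
    (S : ι → U →ₗ[K] U) : Prop where
  idem : ∀ i u, S i (S i u) = S i u
  ortho : ∀ i j u, i ≠ j → S i (S j u) = 0
  sum : ∀ u, ∑ i, S i u = u

/-- `(U₁, W₁)` is a graded subrepresentation of the pair of maps `f, g : U → W`. -/
def IsSubpair {U W : Type} [AddCommGroup U] [Module K U] [AddCommGroup W] [Module K W]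
    (S : ι → U →ₗ[K] U) (T : ι → W →ₗ[K] W) (f g : U →ₗ[K] W)
    (U₁ : Submodule K U) (W₁ : Submodule K W) : Prop :=
  (∀ i, ∀ u ∈ U₁, S i u ∈ U₁) ∧ (∀ i, ∀ w ∈ W₁, T i w ∈ W₁) ∧
    (∀ u ∈ U₁, f u ∈ W₁) ∧ (∀ u ∈ U₁, g u ∈ W₁)

/-- The pair of maps `f, g : U → W` is a direct sum of two nonzero graded pairs. -/
def Decomposes {U W : Type} [AddCommGroup U] [Module K U] [AddCommGroup W] [Module K W]
    (S : ι → U →ₗ[K] U) (T : ι → W →ₗ[K] W) (f g : U →ₗ[K] W) : Prop :=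
  ∃ (U₁ U₂ : Submodule K U) (W₁ W₂ : Submodule K W), IsCompl U₁ U₂ ∧ IsCompl W₁ W₂ ∧
    IsSubpair S T f g U₁ W₁ ∧ IsSubpair S T f g U₂ W₂ ∧
    (U₁ ≠ ⊥ ∨ W₁ ≠ ⊥) ∧ (U₂ ≠ ⊥ ∨ W₂ ≠ ⊥)

/-- A vector and a functional which do not pair to zero after projection to a homogeneous
component give a stable decomposition with a one-dimensional summand. -/
lemma IsProjFamily.exists_isCompl {U : Type} [AddCommGroup U] [Module K U]
    {S : ι → U →ₗ[K] U} (hS : IsProjFamily S) (φ : U →ₗ[K] K) (i : ι) (u : U)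
    (hu : φ (S i u) ≠ 0) :
    IsCompl (K ∙ S i u) (LinearMap.ker (φ ∘ₗ S i)) ∧ (∀ j, ∀ x ∈ K ∙ S i u, S j x ∈ K ∙ S i u) ∧
      ∀ j, ∀ x ∈ LinearMap.ker (φ ∘ₗ S i), S j x ∈ LinearMap.ker (φ ∘ₗ S i) := by
  refine ⟨⟨?_, ?_⟩, ?_, ?_⟩
  · rw [Submodule.disjoint_def]
    intro x hx hx'
    obtain ⟨r, rfl⟩ := Submodule.mem_span_singleton.1 hx
    have : r = 0 := by simpa [hS.idem, hu] using hx'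
    simp [this]
  · rw [codisjoint_iff, eq_top_iff]
    intro x _
    rw [Submodule.mem_sup]
    refine ⟨(φ (S i x) / φ (S i u)) • S i u,
      Submodule.smul_mem _ _ (Submodule.mem_span_singleton_self _),
      x - (φ (S i x) / φ (S i u)) • S i u, ?_, by simp⟩
    simp [hS.idem, hu]
  · intro j x hx
    obtain ⟨r, rfl⟩ := Submodule.mem_span_singleton.1 hx
    by_cases hij : j = i
    · subst hij
      simpa [hS.idem] using hx
    · simp [hS.ortho _ _ _ hij]
  · intro j x hx
    by_cases hij : i = j
    · subst hij
      simpa [hS.idem] using hx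
    · simp [hS.ortho _ _ _ hij]

theorem decomposes_of_lt_left (d : ℕ) : ∀ (U W : Type) [AddCommGroup U] [Module K U]
    [AddCommGroup W] [Module K W] [FiniteDimensional K U] [FiniteDimensional K W]
    (S : ι → U →ₗ[K] U) (T : ι → W →ₗ[K] W) (f g : U →ₗ[K] W) (σ τ : Equiv.Perm ι),
    IsProjFamily S → IsProjFamily T → (∀ i u, f (S i u) = T (σ i) (f u)) →
    (∀ i u, g (S i u) = T (τ i) (g u)) → Module.finrank K U ≤ d →
    Module.finrank K W + 1 < Module.finrank K U → Decomposes S T f g := by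
  classical
  induction d using Nat.strong_induction_on with
  | _ d ih =>
  intro U W _ _ _ _ _ _ S T f g σ τ hS hT hf hg hd hlt
  by_cases hK : ∃ u : U, u ≠ 0 ∧ f u = 0 ∧ g u = 0
  · obtain ⟨u, hu0, hfu, hgu⟩ := hK
    obtain ⟨i, hi⟩ : ∃ i, S i u ≠ 0 := by
      by_contra! h
      exact hu0 (by rw [← hS.sum u]; simp [h])
    obtain ⟨φ, hφ⟩ : ∃ φ : Module.Dual K U, φ (S i u) ≠ 0 := by
      by_contra! h
      exact hi ((Module.forall_dual_apply_eq_zero_iff K _).1 h)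
    obtain ⟨hc, h1, h2⟩ := hS.exists_isCompl φ i u hφ
    refine ⟨_, _, ⊥, ⊤, hc, isCompl_bot_top, ⟨h1, by simp, ?_, ?_⟩, ⟨h2, by simp, by simp, by simp⟩,
      Or.inl (by simpa using hi), Or.inl ?_⟩
    · intro x hx
      obtain ⟨r, rfl⟩ := Submodule.mem_span_singleton.1 hx
      simp [hf, hfu]
    · intro x hx
      obtain ⟨r, rfl⟩ := Submodule.mem_span_singleton.1 hx
      simp [hg, hgu]
    · intro h
      have h' := hc.sup_eq_top
      rw [h, sup_bot_eq] at h'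
      have := finrank_span_singleton (K := K) hi
      rw [h', finrank_top] at this
      omega
  · push Not at hK
    let F : U →ₗ[K] W × W := f.prod g
    have hF : Function.Injective F := by
      rw [injective_iff_map_eq_zero]
      intro u hu
      by_contra h
      have := Prod.ext_iff.1 hu
      exact hK u h this.1 this.2
    let T' : ι → (W × W) →ₗ[K] (W × W) := fun i => (T (σ i)).prodMap (T (τ i))
    have hT' : ∀ i u, T' i (F u) = F (S i u) := by
      intro i u
      simp [T', F, hf, hg]
    let R := LinearMap.range F
    have hR : ∀ i, R ≤ R.comap (T' i) := by
      rintro i _ ⟨u, rfl⟩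
      exact ⟨S i u, (hT' i u).symm⟩
    let TC : ι → ((W × W) ⧸ R) →ₗ[K] ((W × W) ⧸ R) := fun i => R.mapQ R (T' i) (hR i)
    have hTC : IsProjFamily TC := by
      refine ⟨?_, ?_, ?_⟩
      · intro i u
        obtain ⟨u, rfl⟩ := R.mkQ_surjective u
        simp [TC, T', hT.idem]
      · intro i j u hij
        obtain ⟨u, rfl⟩ := R.mkQ_surjective u
        have : T' i (T' j u) = 0 :=
          Prod.ext (hT.ortho _ _ _ (σ.injective.ne hij)) (hT.ortho _ _ _ (τ.injective.ne hij))
        simp only [TC, Submodule.mkQ_apply, Submodule.mapQ_apply]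
        rw [this, Submodule.Quotient.mk_zero]
      · intro u
        obtain ⟨⟨w, w'⟩, rfl⟩ := R.mkQ_surjective u
        have : ∑ i, T' i (w, w') = (w, w') := by
          refine Prod.ext ?_ ?_
          · simp only [T', Prod.fst_sum, LinearMap.prodMap_apply]
            rw [Equiv.sum_comp σ (fun i => T i w), hT.sum]
          · simp only [T', Prod.snd_sum, LinearMap.prodMap_apply]
            rw [Equiv.sum_comp τ (fun i => T i w'), hT.sum]
        simp only [TC, Submodule.mkQ_apply, Submodule.mapQ_apply]
        conv_rhs => rw [← this]
        rw [← Submodule.mkQ_apply, map_sum]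
        rfl
    have hdim : Module.finrank K ((W × W) ⧸ R) + Module.finrank K U =
        Module.finrank K W + Module.finrank K W := by
      rw [← Module.finrank_prod (M := W), ← R.finrank_quotient_add_finrank,
        LinearMap.finrank_range_of_inj hF]
    obtain ⟨W₁, W₂, C₁, C₂, hW, hC, h₁, h₂, hn₁, hn₂⟩ := ih (Module.finrank K W) (by omega) W
      ((W × W) ⧸ R) T TC (R.mkQ ∘ₗ LinearMap.inl K W W) (R.mkQ ∘ₗ LinearMap.inr K W W) σ⁻¹ τ⁻¹
      hT hTC (by intro i u; simp [TC, T']) (by intro i u; simp [TC, T']) le_rfl (by omega)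
    have key : ∀ (W₁ W₂ : Submodule K W) (C₁ C₂ : Submodule K ((W × W) ⧸ R)), IsCompl W₁ W₂ →
        IsCompl C₁ C₂ → IsSubpair T TC (R.mkQ ∘ₗ LinearMap.inl K W W)
          (R.mkQ ∘ₗ LinearMap.inr K W W) W₂ C₂ → (W₁ ≠ ⊥ ∨ C₁ ≠ ⊥) → W₁ ≠ ⊥ := by
      intro W₁ W₂ C₁ C₂ hW hC h₂ hn h
      subst h
      have hW₂ : W₂ = ⊤ := by simpa using hW.sup_eq_top
      have hC₂ : C₂ = ⊤ := by
        rw [eq_top_iff]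
        intro x _
        obtain ⟨⟨w, w'⟩, rfl⟩ := R.mkQ_surjective x
        have e : R.mkQ (w, w') = (R.mkQ ∘ₗ LinearMap.inl K W W) w +
            (R.mkQ ∘ₗ LinearMap.inr K W W) w' := by
          simp [← Submodule.Quotient.mk_add]
        rw [e]
        exact C₂.add_mem (h₂.2.2.1 w (by simp [hW₂])) (h₂.2.2.2 w' (by simp [hW₂]))
      have : C₁ = ⊥ := by simpa [hC₂] using hC.inf_eq_bot
      simp [this] at hn
    refine ⟨W₁.comap f ⊓ W₁.comap g, W₂.comap f ⊓ W₂.comap g, W₁, W₂, ⟨?_, ?_⟩, hW, ?_, ?_,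
      Or.inr (key W₁ W₂ C₁ C₂ hW hC h₂ hn₁), Or.inr (key W₂ W₁ C₂ C₁ hW.symm hC.symm h₁ hn₂)⟩
    · rw [Submodule.disjoint_def]
      intro u hu hu'
      by_contra h0
      exact hK u h0 (Submodule.disjoint_def.1 hW.disjoint _ hu.1 hu'.1)
        (Submodule.disjoint_def.1 hW.disjoint _ hu.2 hu'.2)
    · rw [codisjoint_iff, eq_top_iff]
      intro u _
      obtain ⟨w₁, hw₁, w₂, hw₂, e⟩ := Submodule.mem_sup.1
        (show f u ∈ W₁ ⊔ W₂ by simp [hW.sup_eq_top])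
      obtain ⟨w₁', hw₁', w₂', hw₂', e'⟩ := Submodule.mem_sup.1
        (show g u ∈ W₁ ⊔ W₂ by simp [hW.sup_eq_top])
      have hmem₁ : R.mkQ (w₁, w₁') ∈ C₁ := by
        have := C₁.add_mem (h₁.2.2.1 _ hw₁) (h₁.2.2.2 _ hw₁')
        simpa [← map_add, ← Submodule.Quotient.mk_add] using this
      have hmem₂ : R.mkQ (w₂, w₂') ∈ C₂ := by
        have := C₂.add_mem (h₂.2.2.1 _ hw₂) (h₂.2.2.2 _ hw₂')
        simpa [← map_add, ← Submodule.Quotient.mk_add] using this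
      have hsum : R.mkQ (w₁, w₁') + R.mkQ (w₂, w₂') = 0 := by
        rw [← map_add, Submodule.mkQ_apply, Submodule.Quotient.mk_eq_zero]
        exact ⟨u, by simp [F, e, e']⟩
      have h0 : R.mkQ (w₁, w₁') = 0 := by
        refine Submodule.disjoint_def.1 hC.disjoint _ hmem₁ ?_
        rw [eq_neg_of_add_eq_zero_left hsum]
        exact C₂.neg_mem hmem₂
      rw [Submodule.mkQ_apply, Submodule.Quotient.mk_eq_zero] at h0
      obtain ⟨u₁, hu₁⟩ := h0
      have hu₁f : f u₁ = w₁ := congrArg Prod.fst hu₁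
      have hu₁g : g u₁ = w₁' := congrArg Prod.snd hu₁
      refine Submodule.mem_sup.2 ⟨u₁, ⟨by simpa [hu₁f], by simpa [hu₁g]⟩, u - u₁, ⟨?_, ?_⟩,
        by abel⟩
      · simpa [hu₁f, ← e]
      · simpa [hu₁g, ← e']
    · refine ⟨fun i u hu => ⟨?_, ?_⟩, h₁.1, fun u hu => hu.1, fun u hu => hu.2⟩
      · simpa [hf] using h₁.1 _ _ hu.1
      · simpa [hg] using h₁.1 _ _ hu.2
    · refine ⟨fun i u hu => ⟨?_, ?_⟩, h₂.1, fun u hu => hu.1, fun u hu => hu.2⟩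
      · simpa [hf] using h₂.1 _ _ hu.1
      · simpa [hg] using h₂.1 _ _ hu.2

theorem decomposes_of_lt_right (d : ℕ) : ∀ (U W : Type) [AddCommGroup U] [Module K U]
    [AddCommGroup W] [Module K W] [FiniteDimensional K U] [FiniteDimensional K W]
    (S : ι → U →ₗ[K] U) (T : ι → W →ₗ[K] W) (f g : U →ₗ[K] W) (σ τ : Equiv.Perm ι),
    IsProjFamily S → IsProjFamily T → (∀ i u, f (S i u) = T (σ i) (f u)) →
    (∀ i u, g (S i u) = T (τ i) (g u)) → Module.finrank K W ≤ d →
    Module.finrank K U + 1 < Module.finrank K W → Decomposes S T f g := by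
  classical
  induction d using Nat.strong_induction_on with
  | _ d ih =>
  intro U W _ _ _ _ _ _ S T f g σ τ hS hT hf hg hd hlt
  let G : U × U →ₗ[K] W := f.coprod g
  let S' : ι → (U × U) →ₗ[K] (U × U) := fun i => (S (σ⁻¹ i)).prodMap (S (τ⁻¹ i))
  have hS' : ∀ i u, G (S' i u) = T i (G u) := by
    intro i u
    simp [S', G, hf, hg]
  by_cases hG : LinearMap.range G = ⊤
  · let R := LinearMap.ker G
    have hR : ∀ i, ∀ u ∈ R, S' i u ∈ R := by
      intro i u hu
      have hu' : G u = 0 := hu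
      show G _ = 0
      rw [hS', hu', map_zero]
    let SC : ι → R →ₗ[K] R := fun i => (S' i).restrict (hR i)
    have hSC : IsProjFamily SC := by
      refine ⟨?_, ?_, ?_⟩
      · rintro i ⟨u, hu⟩
        ext <;> simp [SC, S', hS.idem]
      · rintro i j ⟨u, hu⟩ hij
        ext
        · exact hS.ortho _ _ _ (σ⁻¹.injective.ne hij)
        · exact hS.ortho _ _ _ (τ⁻¹.injective.ne hij)
      · rintro ⟨⟨u, u'⟩, hu⟩
        ext
        · simp only [SC, S', LinearMap.restrict_apply, Submodule.coe_sum, Prod.fst_sum,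
            LinearMap.prodMap_apply]
          rw [Equiv.sum_comp σ⁻¹ (fun i => S i u), hS.sum]
        · simp only [SC, S', LinearMap.restrict_apply, Submodule.coe_sum, Prod.snd_sum,
            LinearMap.prodMap_apply]
          rw [Equiv.sum_comp τ⁻¹ (fun i => S i u'), hS.sum]
    have hdim : Module.finrank K W + Module.finrank K R =
        Module.finrank K U + Module.finrank K U := by
      rw [← Module.finrank_prod (M := U), ← G.finrank_range_add_finrank_ker, hG, finrank_top]
    obtain ⟨K₁, K₂, U₁, U₂, hK, hU, h₁, h₂, hn₁, hn₂⟩ := ih (Module.finrank K U) (by omega) R U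
      SC S (LinearMap.fst K U U ∘ₗ R.subtype) (LinearMap.snd K U U ∘ₗ R.subtype) σ⁻¹ τ⁻¹
      hSC hS (by intro i u; simp [SC, S']) (by intro i u; simp [SC, S']) le_rfl (by omega)
    have key : ∀ (U₁ : Submodule K U) (K₁ : Submodule K R), IsSubpair SC S
        (LinearMap.fst K U U ∘ₗ R.subtype) (LinearMap.snd K U U ∘ₗ R.subtype) K₁ U₁ →
        (K₁ ≠ ⊥ ∨ U₁ ≠ ⊥) → U₁ ≠ ⊥ := by
      rintro U₁ K₁ h₁ hn rfl
      have : K₁ = ⊥ := by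
        rw [eq_bot_iff]
        rintro ⟨⟨u, u'⟩, hu⟩ hx
        have h1 := h₁.2.2.1 _ hx
        have h2 := h₁.2.2.2 _ hx
        simp at h1 h2
        simp [h1, h2]
      simp [this] at hn
    have mapsub : ∀ U₁ : Submodule K U, (∀ i, ∀ w ∈ U₁, S i w ∈ U₁) →
        IsSubpair S T f g U₁ ((U₁.prod U₁).map G) := by
      intro U₁ h
      refine ⟨h, ?_, fun u hu => ⟨(u, 0), ⟨hu, U₁.zero_mem⟩, by simp [G]⟩,
        fun u hu => ⟨(0, u), ⟨U₁.zero_mem, hu⟩, by simp [G]⟩⟩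
      rintro i _ ⟨u, hu, rfl⟩
      exact ⟨S' i u, ⟨h _ _ hu.1, h _ _ hu.2⟩, hS' i u⟩
    refine ⟨U₁, U₂, (U₁.prod U₁).map G, (U₂.prod U₂).map G, hU, ⟨?_, ?_⟩, mapsub _ h₁.2.1,
      mapsub _ h₂.2.1, Or.inl (key _ _ h₁ hn₁), Or.inl (key _ _ h₂ hn₂)⟩
    · rw [Submodule.disjoint_def]
      rintro _ ⟨⟨u, u'⟩, hu, rfl⟩ ⟨⟨v, v'⟩, hv, hveq⟩
      have hm : (u, u') - (v, v') ∈ R := by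
        show G _ = 0
        rw [map_sub, hveq, sub_self]
      obtain ⟨k₁, hk₁, k₂, hk₂, e⟩ := Submodule.mem_sup.1
        (show (⟨_, hm⟩ : R) ∈ K₁ ⊔ K₂ by simp [hK.sup_eq_top])
      have e1 := congrArg (fun z : R => z.1.1) e
      have e2 := congrArg (fun z : R => z.1.2) e
      simp only [Submodule.coe_add, Prod.fst_add, Prod.snd_add, Prod.mk_sub_mk] at e1 e2
      have q : ∀ {p p' r r' : U}, p ∈ U₁ → r ∈ U₁ → p' ∈ U₂ → r' ∈ U₂ → r + r' = p - p' →
          p = r := by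
        intro p p' r r' hp hr hp' hr' h
        rw [← sub_eq_zero]
        refine Submodule.disjoint_def.1 hU.disjoint _ (U₁.sub_mem hp hr) ?_
        have : p - r = r' + p' := by
          rw [sub_eq_iff_eq_add, add_comm, ← add_assoc, h]; abel
        rw [this]
        exact U₂.add_mem hr' hp'
      have a1 : u = k₁.1.1 := q hu.1 (h₁.2.2.1 _ hk₁) hv.1 (h₂.2.2.1 _ hk₂) e1
      have a2 : u' = k₁.1.2 := q hu.2 (h₁.2.2.2 _ hk₁) hv.2 (h₂.2.2.2 _ hk₂) e2
      have : (u, u') = k₁.1 := Prod.ext a1 a2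
      rw [this]
      exact k₁.2
    · rw [codisjoint_iff, eq_top_iff, ← hG]
      rintro _ ⟨⟨u, u'⟩, rfl⟩
      rw [← Submodule.map_sup]
      obtain ⟨w₁, hw₁, w₂, hw₂, e⟩ := Submodule.mem_sup.1
        (show u ∈ U₁ ⊔ U₂ by simp [hU.sup_eq_top])
      obtain ⟨w₁', hw₁', w₂', hw₂', e'⟩ := Submodule.mem_sup.1
        (show u' ∈ U₁ ⊔ U₂ by simp [hU.sup_eq_top])
      refine ⟨(u, u'), Submodule.mem_sup.2 ⟨(w₁, w₁'), ⟨hw₁, hw₁'⟩, (w₂, w₂'), ⟨hw₂, hw₂'⟩, ?_⟩,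
        rfl⟩
      simp [e, e']
  · obtain ⟨φ, hφ0, hφ⟩ := Submodule.exists_le_ker_of_lt_top _ (lt_top_iff_ne_top.2 hG)
    obtain ⟨w, hw⟩ : ∃ w, φ w ≠ 0 := by
      by_contra! h
      exact hφ0 (LinearMap.ext h)
    obtain ⟨i, hi⟩ : ∃ i, φ (T i w) ≠ 0 := by
      by_contra! h
      exact hw (by rw [← hT.sum w, map_sum]; simp [h])
    have hφf : ∀ u, φ (f u) = 0 := fun u => hφ ⟨(u, 0), by simp [G]⟩
    have hφg : ∀ u, φ (g u) = 0 := fun u => hφ ⟨(0, u), by simp [G]⟩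
    have hTf : ∀ u, T i (f u) = f (S (σ⁻¹ i) u) := fun u => by simp [hf]
    have hTg : ∀ u, T i (g u) = g (S (τ⁻¹ i) u) := fun u => by simp [hg]
    obtain ⟨hc, h1, h2⟩ := hT.exists_isCompl φ i w hi
    have hi' : T i w ≠ 0 := fun h => hi (by rw [h, map_zero])
    refine ⟨⊥, ⊤, _, _, isCompl_bot_top, hc, ⟨by simp, h1, by simp, by simp⟩,
      ⟨by simp, h2, fun u _ => ?_, fun u _ => ?_⟩, Or.inr (by simpa using hi'), Or.inr ?_⟩
    · simp [hTf, hφf]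
    · simp [hTg, hφg]
    · intro h
      have h' := hc.sup_eq_top
      rw [h, sup_bot_eq] at h'
      have := finrank_span_singleton (K := K) hi'
      rw [h', finrank_top] at this
      omega
end Pairs

section Double
open Polynomial

variable {K R : Type} [Field K] [Ring R] [Algebra K R]

/-- Relations in a `K`-algebra `R` generated by `b, c, d, t`, where `t` is the modification
`a + F (c ^ m - q b) d ^ (n - 1)` of the generator `a`, with `q = ξ ^ m`. -/
structure IsDouble (m n : ℕ) (ξ F : K) (b c d t : R) : Prop where
  one_lt_m : 1 < m
  one_lt_n : 1 < n
  prim : IsPrimitiveRoot ξ (m * n)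
  c_pow : c ^ (m * n) = 1
  d_pow : d ^ n = 0
  b_c : b * c = c * b
  t_b : t * b = ξ ^ m • (b * t)
  c_t : c * t = ξ • (t * c)
  d_c : d * c = ξ • (c * d)
  b_d : b * d = ξ ^ m • (d * b)
  t_d : t * d - d * t = b - c ^ m
  a_pow : (t - F • ((c ^ m - ξ ^ m • b) * d ^ (n - 1))) ^ n = b ^ n - 1
  gen : Algebra.adjoin K {b, c, d, t} = ⊤

/-- The projection onto the `γ`-eigenspace of an element `c` with `c ^ N = 1`. -/
noncomputable def eigProj (N : ℕ) (c : R) (γ : K) : R :=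
  (N : K)⁻¹ • ∑ r ∈ Finset.range N, γ⁻¹ ^ r • c ^ r

lemma mul_eigProj {N : ℕ} {c : R} (hc : c ^ N = 1) {γ : K} (hγ : γ ^ N = 1) (hN : N ≠ 0) :
    c * eigProj N c γ = γ • eigProj N c γ := by
  have hγ0 : γ ≠ 0 := by
    rintro rfl
    simp [hN] at hγ
  have h : ∑ r ∈ Finset.range N, γ⁻¹ ^ (r + 1) • c ^ (r + 1) =
      ∑ r ∈ Finset.range N, γ⁻¹ ^ r • c ^ r := by
    have := Finset.sum_range_succ' (fun r => γ⁻¹ ^ r • c ^ r) N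
    rw [Finset.sum_range_succ] at this
    simpa [hc, hγ] using this.symm
  rw [eigProj, mul_smul_comm, smul_comm γ]
  congr 1
  conv_rhs => rw [← h]
  rw [Finset.mul_sum, Finset.smul_sum]
  refine Finset.sum_congr rfl fun r _ => ?_
  rw [mul_smul_comm, smul_smul, ← pow_succ', pow_succ' γ⁻¹, ← mul_assoc, mul_inv_cancel₀ hγ0,
    one_mul]

/-- Summing over all `N`-th roots of unity amounts to summing over powers of a primitive one. -/
lemma sum_nthRootsFinset {N : ℕ} {ξ : K} (hξ : IsPrimitiveRoot ξ N) (hN : 0 < N) {A : Type}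
    [AddCommMonoid A] (f : K → A) :
    ∑ γ ∈ nthRootsFinset N (1 : K), f γ = ∑ k ∈ Finset.range N, f (ξ ^ k) := by
  symm
  refine Finset.sum_nbij (fun k => ξ ^ k) ?_ ?_ ?_ (fun _ _ => rfl)
  · intro k _
    rw [mem_nthRootsFinset hN, ← pow_mul, mul_comm, pow_mul, hξ.pow_eq_one, one_pow]
  · intro i hi j hj h
    exact hξ.pow_inj (by simpa using hi) (by simpa using hj) h
  · intro γ hγ
    have : NeZero N := ⟨hN.ne'⟩
    obtain ⟨i, hi, rfl⟩ := hξ.eq_pow_of_pow_eq_one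
      ((mem_nthRootsFinset hN (1 : K)).1 (Finset.mem_coe.1 hγ))
    exact ⟨i, by simpa using hi, rfl⟩

lemma geom_sum_eq_zero_of_ne {N : ℕ} {z : K} (hz : z ^ N = 1) (h1 : z ≠ 1) :
    ∑ r ∈ Finset.range N, z ^ r = 0 := by
  have := geom_sum_mul z N
  rw [hz, sub_self] at this
  exact (mul_eq_zero.1 this).resolve_right (sub_ne_zero.2 h1)

lemma sum_eigProj {N : ℕ} {c : R} {ξ : K} (hξ : IsPrimitiveRoot ξ N) (hN : 0 < N) :
    ∑ γ ∈ nthRootsFinset N (1 : K), eigProj N c γ = 1 := by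
  have : NeZero N := ⟨hN.ne'⟩
  have := hξ.neZero'
  have hN' : (N : K) ≠ 0 := NeZero.ne _
  rw [sum_nthRootsFinset hξ hN]
  simp only [eigProj]
  rw [← Finset.smul_sum, Finset.sum_comm, Finset.sum_eq_single 0]
  · simp [← Nat.cast_smul_eq_nsmul K, smul_smul, hN']
  · intro r hr hr0
    rw [← Finset.sum_smul]
    have : ∑ k ∈ Finset.range N, (ξ ^ k)⁻¹ ^ r = 0 := by
      have e : ∀ k, (ξ ^ k)⁻¹ ^ r = ((ξ ^ r)⁻¹) ^ k := by
        intro k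
        rw [inv_pow, inv_pow, ← pow_mul, ← pow_mul, mul_comm]
      simp only [e]
      apply geom_sum_eq_zero_of_ne
      · rw [inv_pow, ← pow_mul, mul_comm, pow_mul, hξ.pow_eq_one, one_pow, inv_one]
      · intro h
        exact hξ.pow_ne_one_of_pos_of_lt hr0 (Finset.mem_range.1 hr) (inv_eq_one.1 h)
    rw [this, zero_smul]
  · intro h
    exact absurd (Finset.mem_range.2 hN) h

lemma mul_eigProj_of_mul {N : ℕ} {c x : R} {s : K} (hx : x * c = s⁻¹ • (c * x))
    (γ : K) : x * eigProj N c γ = eigProj N c (s * γ) * x := by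
  have h : ∀ r : ℕ, x * c ^ r = s⁻¹ ^ r • (c ^ r * x) := by
    intro r
    induction r with
    | zero => simp
    | succ r ih =>
      rw [pow_succ, ← mul_assoc, ih, smul_mul_assoc, mul_assoc, hx, mul_smul_comm, smul_smul,
        mul_assoc, ← pow_succ]
  rw [eigProj, eigProj, mul_smul_comm, smul_mul_assoc, Finset.mul_sum, Finset.sum_mul]
  congr 1
  refine Finset.sum_congr rfl fun r _ => ?_
  rw [mul_smul_comm, h, smul_mul_assoc, smul_smul, mul_inv, mul_pow, mul_comm]

section Mod
variable {M : Type} [AddCommGroup M] [Module K M] [Module R M] [IsScalarTower K R M]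

lemma pow_smul_of_smul {c : R} {γ : K} {v : M} (h : c • v = γ • v) (r : ℕ) :
    c ^ r • v = γ ^ r • v := by
  induction r with
  | zero => simp
  | succ r ih => rw [pow_succ, mul_smul, h, smul_comm, ih, smul_smul, ← pow_succ']

open Classical in
lemma eigProj_smul {N : ℕ} {c : R} {ξ : K} (hξ : IsPrimitiveRoot ξ N) (hN : 0 < N) {γ δ : K}
    (hγ : γ ^ N = 1) (hδ : δ ^ N = 1) {v : M} (h : c • v = γ • v) :
    eigProj N c δ • v = if δ = γ then v else 0 := by
  have : NeZero N := ⟨hN.ne'⟩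
  have := hξ.neZero'
  have hN' : (N : K) ≠ 0 := NeZero.ne _
  have hδ0 : δ ≠ 0 := by
    rintro rfl
    simp [hN.ne'] at hδ
  have e : ∀ r : ℕ, (δ⁻¹ ^ r • c ^ r) • v = (δ⁻¹ * γ) ^ r • v := by
    intro r
    rw [smul_assoc, pow_smul_of_smul h, smul_smul, mul_pow]
  rw [eigProj, smul_assoc, Finset.sum_smul]
  simp only [e]
  rw [← Finset.sum_smul, smul_smul]
  split_ifs with h'
  · subst h'
    simp [inv_mul_cancel₀ hδ0, hN']
  · rw [geom_sum_eq_zero_of_ne, mul_zero, zero_smul]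
    · rw [mul_pow, inv_pow, hδ, hγ, inv_one, one_mul]
    · intro h1
      exact h' (by rw [inv_mul_eq_one₀ hδ0] at h1; exact h1)

end Mod

/-- The Casimir element of `R`. -/
def casimir (m : ℕ) (ξ : K) (b c d t : R) : R :=
  ξ ^ m • b + c ^ m - (ξ ^ m - 1) • (t * d)

namespace IsDouble

variable {m n : ℕ} {ξ F : K} {b c d t : R}

lemma ne_zero (h : IsDouble m n ξ F b c d t) : m * n ≠ 0 :=
  Nat.mul_ne_zero (by have := h.one_lt_m; omega) (by have := h.one_lt_n; omega)

lemma xi_ne_zero (h : IsDouble m n ξ F b c d t) : ξ ≠ 0 :=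
  h.prim.ne_zero h.ne_zero

lemma q_ne_one (h : IsDouble m n ξ F b c d t) : ξ ^ m - 1 ≠ 0 := by
  rw [sub_ne_zero]
  have h1 := h.one_lt_m
  refine h.prim.pow_ne_one_of_pos_of_lt (by omega) ?_
  have := Nat.mul_lt_mul_of_pos_left h.one_lt_n (show 0 < m by omega)
  simpa using this

lemma xi_pow_n_ne_one (h : IsDouble m n ξ F b c d t) : ξ ^ n ≠ 1 := by
  have h1 := h.one_lt_n
  refine h.prim.pow_ne_one_of_pos_of_lt (by omega) ?_
  have := Nat.mul_lt_mul_of_pos_right h.one_lt_m (show 0 < n by omega)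
  simpa using this

lemma c_pow_t (h : IsDouble m n ξ F b c d t) (k : ℕ) : c ^ k * t = ξ ^ k • (t * c ^ k) := by
  induction k with
  | zero => simp
  | succ k ih =>
    rw [pow_succ, mul_assoc, h.c_t, mul_smul_comm, ← mul_assoc, ih, smul_mul_assoc, smul_smul,
      mul_assoc, ← pow_succ']

lemma d_c_pow (h : IsDouble m n ξ F b c d t) (k : ℕ) : d * c ^ k = ξ ^ k • (c ^ k * d) := by
  induction k with
  | zero => simp
  | succ k ih =>
    rw [pow_succ, ← mul_assoc, ih, smul_mul_assoc, mul_assoc, h.d_c, mul_smul_comm, smul_smul,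
      ← mul_assoc, ← pow_succ]

lemma d_t (h : IsDouble m n ξ F b c d t) : d * t = t * d - b + c ^ m := by
  rw [sub_add, ← h.t_d, sub_sub_cancel]

lemma casimir_eq (h : IsDouble m n ξ F b c d t) :
    casimir m ξ b c d t = b + ξ ^ m • c ^ m - (ξ ^ m - 1) • (d * t) := by
  rw [casimir, h.d_t]
  module

/-- An element commuting with the generators is central. -/
lemma commute_of_gen (h : IsDouble m n ξ F b c d t) {z : R} (hb : z * b = b * z)
    (hc : z * c = c * z) (hd : z * d = d * z) (ht : z * t = t * z) (r : R) : z * r = r * z := by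
  have hr : r ∈ Algebra.adjoin K {b, c, d, t} := h.gen ▸ Algebra.mem_top
  induction hr using Algebra.adjoin_induction with
  | mem x hx =>
    rcases hx with rfl | rfl | rfl | rfl <;> assumption
  | algebraMap k => exact (Algebra.commutes k z).symm
  | add x y _ _ hx hy => rw [mul_add, add_mul, hx, hy]
  | mul x y _ _ hx hy => rw [← mul_assoc, hx, mul_assoc, hy, mul_assoc]

lemma casimir_central (h : IsDouble m n ξ F b c d t) (r : R) :
    casimir m ξ b c d t * r = r * casimir m ξ b c d t := by
  have hbc : b * c ^ m = c ^ m * b := (Commute.pow_right (show Commute b c from h.b_c) m)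
  have htdb : t * d * b = b * (t * d) := by
    have h1 : ξ ^ m • (d * b) = b * d := h.b_d.symm
    have hq : ξ ^ m ≠ 0 := pow_ne_zero _ h.xi_ne_zero
    have h2 : d * b = (ξ ^ m)⁻¹ • (b * d) := by
      rw [h.b_d, smul_smul, inv_mul_cancel₀ hq, one_smul]
    rw [mul_assoc, h2, mul_smul_comm, ← mul_assoc, h.t_b, smul_mul_assoc, smul_smul,
      inv_mul_cancel₀ hq, one_smul, mul_assoc]
  have htdc : t * d * c = c * (t * d) := by
    rw [mul_assoc, h.d_c, mul_smul_comm, ← mul_assoc c, h.c_t, smul_mul_assoc, mul_assoc]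
  refine h.commute_of_gen ?_ ?_ ?_ ?_ r
  · simp only [casimir, add_mul, sub_mul, mul_add, mul_sub, smul_mul_assoc, mul_smul_comm, htdb,
      hbc]
  · simp only [casimir, add_mul, sub_mul, mul_add, mul_sub, smul_mul_assoc, mul_smul_comm, htdc,
      h.b_c, ← pow_succ, ← pow_succ']
  · conv_lhs => rw [h.casimir_eq]
    simp only [casimir, add_mul, sub_mul, mul_add, mul_sub, smul_mul_assoc, mul_smul_comm, h.b_d,
      h.d_c_pow, mul_assoc]
  · conv_rhs => rw [h.casimir_eq]
    simp only [casimir, add_mul, sub_mul, mul_add, mul_sub, smul_mul_assoc, mul_smul_comm, h.t_b,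
      h.c_pow_t, mul_assoc]

lemma bc_central (h : IsDouble m n ξ F b c d t) (r : R) : b * c ^ m * r = r * (b * c ^ m) := by
  have hbc : b * c ^ m = c ^ m * b := (Commute.pow_right (show Commute b c from h.b_c) m)
  have hq : ξ ^ m ≠ 0 := pow_ne_zero _ h.xi_ne_zero
  refine h.commute_of_gen ?_ ?_ ?_ ?_ r
  · rw [mul_assoc, ← hbc]
  · rw [mul_assoc, ← mul_assoc c, ← h.b_c, mul_assoc, ← pow_succ, ← pow_succ']
  · rw [← mul_assoc d, hbc, mul_assoc, h.b_d, mul_smul_comm, ← mul_assoc, ← smul_mul_assoc,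
      ← h.d_c_pow, mul_assoc, ← hbc, mul_assoc]
  · rw [mul_assoc, h.c_pow_t, mul_smul_comm, ← mul_assoc t, h.t_b, smul_mul_assoc, mul_assoc]

end IsDouble

end Double

section Double
open Polynomial

set_option linter.unusedSectionVars false

variable {K R : Type} [Field K] [Ring R] [Algebra K R] {m n : ℕ} {ξ F ρ κ : K} {b c d t : R}

/-- A weight `γ` which is the weight of a highest weight vector in the block given by `ρ`, `κ`. -/
def IsCut (m n : ℕ) (ξ ρ κ γ : K) : Prop :=
  γ ^ (m * n) = 1 ∧ ξ ^ m * ρ * (γ ^ m)⁻¹ + γ ^ m = κ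

open Classical in
/-- The finite set of highest weights of a block. -/
def cutset (m n : ℕ) (ξ ρ κ : K) : Finset K :=
  (nthRootsFinset (m * n) (1 : K)).filter (IsCut m n ξ ρ κ)

/-- The projection onto the highest weight spaces of a block. -/
def cutProj (m n : ℕ) (ξ ρ κ : K) (c : R) : R :=
  ∑ γ ∈ cutset m n ξ ρ κ, eigProj (m * n) c γ

/-- The `K`-subspace spanned by all `t ^ j • w` with `w ∈ P`. -/
def powSpan {M : Type} [AddCommGroup M] [Module K M] [Module R M] (t : R) (P : Submodule K M) :
    Submodule K M :=
  Submodule.span K {x | ∃ j : ℕ, ∃ w ∈ P, x = t ^ j • w}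

/-- `M` lies in the block given by the eigenvalue `ρ` of `b c ^ m` and the generalised eigenvalue
`κ` of the Casimir element. -/
structure IsBlk (m : ℕ) (ξ ρ κ : K) (b c d t : R) (M : Type) [AddCommGroup M] [Module K M]
    [Module R M] : Prop where
  bc : ∀ w : M, (b * c ^ m) • w = ρ • w
  nilp : ∃ k : ℕ, ∀ w : M, (casimir m ξ b c d t - algebraMap K R κ) ^ k • w = 0

lemma mem_cutset {γ : K} (hN : m * n ≠ 0) : γ ∈ cutset m n ξ ρ κ ↔ IsCut m n ξ ρ κ γ := by
  classical
  rw [cutset, Finset.mem_filter, mem_nthRootsFinset (Nat.pos_of_ne_zero hN)]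
  exact ⟨fun h => h.2, fun h => ⟨h.1, h⟩⟩

variable {M : Type} [AddCommGroup M] [Module K M] [Module R M] [IsScalarTower K R M]

namespace IsBlk

lemma of_submodule (hM : IsBlk m ξ ρ κ b c d t M) (S : Submodule R M) :
    IsBlk m ξ ρ κ b c d t S := by
  obtain ⟨k, hk⟩ := hM.nilp
  exact ⟨fun w => Subtype.ext (hM.bc w), k, fun w => Subtype.ext (hk w)⟩

lemma quotient (hM : IsBlk m ξ ρ κ b c d t M) (S : Submodule R M) :
    IsBlk m ξ ρ κ b c d t (M ⧸ S) := by
  obtain ⟨k, hk⟩ := hM.nilp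
  refine ⟨fun w => ?_, k, fun w => ?_⟩
  · obtain ⟨w, rfl⟩ := S.mkQ_surjective w
    rw [← map_smul, hM.bc]
    rfl
  · obtain ⟨w, rfl⟩ := S.mkQ_surjective w
    rw [← map_smul, hk, map_zero]

end IsBlk

lemma eq_zero_of_smul {γ δ : K} {v : M} (h1 : γ • v = δ • v) (h : γ ≠ δ) :
    v = 0 := by
  have := sub_smul γ δ v
  rw [h1, sub_self] at this
  exact (smul_eq_zero.1 this).resolve_left (sub_ne_zero.2 h)

namespace IsDouble

lemma ne_zero_of_pow (h : IsDouble m n ξ F b c d t) {γ : K} (hγ : γ ^ (m * n) = 1) : γ ≠ 0 := by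
  rintro rfl
  simp [h.ne_zero] at hγ

lemma pow_mul_pow (h : IsDouble m n ξ F b c d t) {γ : K} (hγ : γ ^ (m * n) = 1) (j : ℕ) :
    (ξ ^ j * γ) ^ (m * n) = 1 := by
  rw [mul_pow, hγ, ← pow_mul, mul_comm j, pow_mul, h.prim.pow_eq_one, one_pow, one_mul]

lemma c_t_pow_smul (h : IsDouble m n ξ F b c d t) {γ : K} {v : M} (hv : c • v = γ • v) (j : ℕ) :
    c • t ^ j • v = (ξ ^ j * γ) • t ^ j • v := by
  induction j with
  | zero => simpa using hv
  | succ j ih =>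
    rw [pow_succ', mul_smul, ← mul_smul c, h.c_t, smul_assoc, mul_smul, ih, smul_comm t, smul_smul,
      pow_succ', mul_assoc]

lemma c_d (h : IsDouble m n ξ F b c d t) : c * d = ξ⁻¹ • (d * c) := by
  rw [h.d_c, smul_smul, inv_mul_cancel₀ h.xi_ne_zero, one_smul]

lemma c_d_pow_smul (h : IsDouble m n ξ F b c d t) {γ : K} {v : M} (hv : c • v = γ • v) (j : ℕ) :
    c • d ^ j • v = (ξ⁻¹ ^ j * γ) • d ^ j • v := by
  induction j with
  | zero => simpa using hv
  | succ j ih =>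
    rw [pow_succ' d, mul_smul, ← mul_smul c, h.c_d, smul_assoc, mul_smul, ih, smul_comm d,
      smul_smul, pow_succ', mul_assoc]

lemma c_d_smul (h : IsDouble m n ξ F b c d t) {γ : K} {v : M} (hv : c • v = γ • v) :
    c • d • v = (ξ⁻¹ * γ) • d • v := by
  simpa using h.c_d_pow_smul hv 1

lemma c_eigProj_smul (h : IsDouble m n ξ F b c d t) {γ : K} (hγ : γ ^ (m * n) = 1) (v : M) :
    c • eigProj (m * n) c γ • v = γ • eigProj (m * n) c γ • v := by
  rw [← mul_smul, mul_eigProj h.c_pow hγ h.ne_zero, smul_assoc]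

lemma sum_eigProj_smul (h : IsDouble m n ξ F b c d t) (v : M) :
    ∑ γ ∈ nthRootsFinset (m * n) (1 : K), eigProj (m * n) c γ • v = v := by
  rw [← Finset.sum_smul, sum_eigProj h.prim (Nat.pos_of_ne_zero h.ne_zero), one_smul]

/-- A module is spanned by its weight vectors. -/
lemma weight_induction (h : IsDouble m n ξ F b c d t) {p : M → Prop} (zero : p 0)
    (add : ∀ v w, p v → p w → p (v + w))
    (weight : ∀ (γ : K) (v : M), γ ^ (m * n) = 1 → c • v = γ • v → p v) (v : M) : p v := by
  rw [← h.sum_eigProj_smul v]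
  refine Finset.sum_induction _ p add zero fun γ hγ => ?_
  have hγ' := (mem_nthRootsFinset (Nat.pos_of_ne_zero h.ne_zero) (1 : K)).1 hγ
  exact weight γ _ hγ' (h.c_eigProj_smul hγ' v)

lemma cutProj_smul (h : IsDouble m n ξ F b c d t) {γ : K} (hγ : IsCut m n ξ ρ κ γ)
    {v : M} (hv : c • v = γ • v) : cutProj m n ξ ρ κ c • v = v := by
  classical
  rw [cutProj, Finset.sum_smul, Finset.sum_eq_single γ]
  · rw [eigProj_smul h.prim (Nat.pos_of_ne_zero h.ne_zero) hγ.1 hγ.1 hv, if_pos rfl]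
  · intro δ hδ hne
    rw [mem_cutset h.ne_zero] at hδ
    rw [eigProj_smul h.prim (Nat.pos_of_ne_zero h.ne_zero) hγ.1 hδ.1 hv, if_neg hne]
  · intro h'
    exact absurd ((mem_cutset h.ne_zero).2 hγ) h'

lemma cutProj_smul_of_not (h : IsDouble m n ξ F b c d t) {γ : K} (hγ' : γ ^ (m * n) = 1)
    (hγ : ¬ IsCut m n ξ ρ κ γ) {v : M} (hv : c • v = γ • v) : cutProj m n ξ ρ κ c • v = 0 := by
  classical
  rw [cutProj, Finset.sum_smul]
  refine Finset.sum_eq_zero fun δ hδ => ?_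
  rw [mem_cutset h.ne_zero] at hδ
  rw [eigProj_smul h.prim (Nat.pos_of_ne_zero h.ne_zero) hγ' hδ.1 hv, if_neg]
  rintro rfl
  exact hγ hδ

lemma cutProj_cutProj_smul (h : IsDouble m n ξ F b c d t) (v : M) :
    cutProj m n ξ ρ κ c • cutProj m n ξ ρ κ c • v = cutProj m n ξ ρ κ c • v := by
  refine h.weight_induction (p := fun v : M => cutProj m n ξ ρ κ c • cutProj m n ξ ρ κ c • v =
    cutProj m n ξ ρ κ c • v) (by simp) (fun v w hv hw => by simp only [smul_add, hv, hw])
    (fun γ v hγ hv => ?_) v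
  · by_cases hc : IsCut m n ξ ρ κ γ
    · simp only [h.cutProj_smul hc hv]
    · simp only [h.cutProj_smul_of_not hγ hc hv, smul_zero]

lemma b_smul (h : IsDouble m n ξ F b c d t) (hM : IsBlk m ξ ρ κ b c d t M) {γ : K}
    (hγ : γ ^ (m * n) = 1) {v : M} (hv : c • v = γ • v) : b • v = (ρ * (γ ^ m)⁻¹) • v := by
  have h1 := hM.bc v
  rw [mul_smul, pow_smul_of_smul hv, smul_comm] at h1
  have h2 : γ ^ m ≠ 0 := pow_ne_zero _ (h.ne_zero_of_pow hγ)
  rw [mul_comm, mul_smul, ← h1, smul_smul, inv_mul_cancel₀ h2, one_smul]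

lemma casimir_smul (h : IsDouble m n ξ F b c d t) (hM : IsBlk m ξ ρ κ b c d t M) {γ : K}
    (hγ : γ ^ (m * n) = 1) {v : M} (hv : c • v = γ • v) :
    casimir m ξ b c d t • v =
      (ξ ^ m * ρ * (γ ^ m)⁻¹ + γ ^ m) • v - (ξ ^ m - 1) • t • d • v := by
  rw [casimir, sub_smul, add_smul, smul_assoc, smul_assoc, h.b_smul hM hγ hv, mul_smul t,
    pow_smul_of_smul hv]
  generalize t • d • v = x
  module

lemma casimir_smul' (h : IsDouble m n ξ F b c d t) (hM : IsBlk m ξ ρ κ b c d t M) {γ : K}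
    (hγ : γ ^ (m * n) = 1) {v : M} (hv : c • v = γ • v) :
    casimir m ξ b c d t • v =
      (ρ * (γ ^ m)⁻¹ + ξ ^ m * γ ^ m) • v - (ξ ^ m - 1) • d • t • v := by
  rw [h.casimir_eq, sub_smul, add_smul, smul_assoc, smul_assoc, h.b_smul hM hγ hv, mul_smul d,
    pow_smul_of_smul hv]
  generalize d • t • v = x
  module

/-- A `K`-subspace stable under the generators is a submodule. -/
lemma exists_submodule (h : IsDouble m n ξ F b c d t) (P : Submodule K M)
    (hb : ∀ v ∈ P, b • v ∈ P) (hc : ∀ v ∈ P, c • v ∈ P) (hd : ∀ v ∈ P, d • v ∈ P)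
    (ht : ∀ v ∈ P, t • v ∈ P) : ∃ N : Submodule R M, ∀ v, v ∈ N ↔ v ∈ P := by
  refine ⟨{ P.toAddSubmonoid with smul_mem' := ?_ }, fun v => Iff.rfl⟩
  intro r
  have hr : r ∈ Algebra.adjoin K {b, c, d, t} := h.gen ▸ Algebra.mem_top
  induction hr using Algebra.adjoin_induction with
  | mem x hx => rcases hx with rfl | rfl | rfl | rfl <;> assumption
  | algebraMap k =>
    intro v hv
    rw [algebraMap_smul]
    exact P.smul_mem k hv
  | add x y _ _ hx hy =>
    intro v hv
    rw [add_smul]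
    exact P.add_mem (hx hv) (hy hv)
  | mul x y _ _ hx hy =>
    intro v hv
    rw [mul_smul]
    exact hx (hy hv)

lemma subset_powSpan (t : R) (P : Submodule K M) : P ≤ powSpan t P :=
  fun w hw => Submodule.subset_span ⟨0, w, hw, by simp⟩

lemma t_smul_mem_powSpan (t : R) (P : Submodule K M) {v : M} (hv : v ∈ powSpan t P) :
    t • v ∈ powSpan t P := by
  induction hv using Submodule.span_induction with
  | mem x hx =>
    obtain ⟨j, w, hw, rfl⟩ := hx
    exact Submodule.subset_span ⟨j + 1, w, hw, by rw [pow_succ', mul_smul]⟩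
  | zero => simp
  | add x y _ _ hx hy => rw [smul_add]; exact add_mem hx hy
  | smul k x _ hx => rw [smul_comm]; exact Submodule.smul_mem _ _ hx

/-- The span of the `t`-orbits of a `c`-stable subspace is a submodule as soon as it contains the
image under `d` of the subspace. -/
lemma exists_submodule_powSpan (h : IsDouble m n ξ F b c d t) (hM : IsBlk m ξ ρ κ b c d t M)
    (P : Submodule K M) (hc : ∀ v ∈ P, c • v ∈ P) (hd : ∀ v ∈ P, d • v ∈ powSpan t P) :
    ∃ N : Submodule R M, ∀ v, v ∈ N ↔ v ∈ powSpan t P := by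
  have hcQ : ∀ v ∈ powSpan t P, c • v ∈ powSpan t P := by
    intro v hv
    induction hv using Submodule.span_induction with
    | mem x hx =>
      obtain ⟨j, w, hw, rfl⟩ := hx
      have e : c * t ^ j = ξ ^ j • (t ^ j * c) := by
        induction j with
        | zero => simp
        | succ j ih =>
          rw [pow_succ' t, ← mul_assoc, h.c_t, smul_mul_assoc, mul_assoc, ih, mul_smul_comm,
            smul_smul, mul_assoc, pow_succ']
      rw [← mul_smul, e, smul_assoc, mul_smul]
      exact Submodule.smul_mem _ _ (Submodule.subset_span ⟨j, _, hc w hw, rfl⟩)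
    | zero => simp
    | add x y _ _ hx hy => rw [smul_add]; exact add_mem hx hy
    | smul k x _ hx => rw [smul_comm]; exact Submodule.smul_mem _ _ hx
  have hcpQ : ∀ (k : ℕ), ∀ v ∈ powSpan t P, c ^ k • v ∈ powSpan t P := by
    intro k
    induction k with
    | zero => simp
    | succ k ih =>
      intro v hv
      rw [pow_succ, mul_smul]
      exact ih _ (hcQ v hv)
  have hbQ : ∀ v ∈ powSpan t P, b • v ∈ powSpan t P := by
    intro v hv
    have e : b • v = ρ • c ^ (m * n - m) • v := by
      have hmn : m * n - m + m = m * n :=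
        Nat.sub_add_cancel (Nat.le_mul_of_pos_right _ (by have := h.one_lt_n; omega))
      rw [smul_comm, ← hM.bc, ← mul_smul, (Commute.pow_right (show Commute b c from h.b_c) m).eq, ← mul_assoc,
        ← pow_add, hmn, h.c_pow, one_mul]
    rw [e]
    exact Submodule.smul_mem _ _ (hcpQ _ v hv)
  refine h.exists_submodule _ hbQ hcQ ?_ fun v hv => t_smul_mem_powSpan t P hv
  intro v hv
  induction hv using Submodule.span_induction with
  | mem x hx =>
    obtain ⟨j, w, hw, rfl⟩ := hx
    induction j with
    | zero => simpa using hd w hw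
    | succ j ih =>
      have hj : t ^ j • w ∈ powSpan t P := Submodule.subset_span ⟨j, w, hw, rfl⟩
      rw [pow_succ', mul_smul, ← mul_smul d, h.d_t, add_smul, sub_smul, mul_smul t]
      exact add_mem (sub_mem (t_smul_mem_powSpan t P ih) (hbQ _ hj)) (hcpQ _ _ hj)
  | zero => simp
  | add x y _ _ hx hy => rw [smul_add]; exact add_mem hx hy
  | smul k x _ hx => rw [smul_comm]; exact Submodule.smul_mem _ _ hx

/-- The distance from a highest weight to the next highest weight. -/
def step (m n : ℕ) (ξ ρ κ γ : K) : ℕ := sInf {j | 1 ≤ j ∧ IsCut m n ξ ρ κ (ξ ^ j * γ)}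

lemma step_spec (h : IsDouble m n ξ F b c d t) {γ : K} (hγ : IsCut m n ξ ρ κ γ) :
    1 ≤ step m n ξ ρ κ γ ∧ IsCut m n ξ ρ κ (ξ ^ step m n ξ ρ κ γ * γ) := by
  refine Nat.sInf_mem (s := {j | 1 ≤ j ∧ IsCut m n ξ ρ κ (ξ ^ j * γ)}) ⟨m * n, ?_, ?_⟩
  · exact Nat.one_le_iff_ne_zero.2 h.ne_zero
  · rwa [h.prim.pow_eq_one, one_mul]

lemma not_isCut_of_lt_step {γ : K} {j : ℕ} (h1 : 1 ≤ j) (hj : j < step m n ξ ρ κ γ) :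
    ¬ IsCut m n ξ ρ κ (ξ ^ j * γ) :=
  fun hc => Nat.notMem_of_lt_sInf hj ⟨h1, hc⟩

/-- Every nonzero module in a block has a highest weight vector. -/
lemma exists_highest (h : IsDouble m n ξ F b c d t) (hM : IsBlk m ξ ρ κ b c d t M)
    [Nontrivial M] :
    ∃ (γ : K) (v : M), IsCut m n ξ ρ κ γ ∧ v ≠ 0 ∧ c • v = γ • v ∧ d • v = 0 := by
  obtain ⟨w, hw⟩ := exists_ne (0 : M)
  obtain ⟨u, hu, hdu⟩ : ∃ u : M, u ≠ 0 ∧ d • u = 0 := by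
    have hex : ∃ j, d ^ j • w = 0 := ⟨n, by rw [h.d_pow, zero_smul]⟩
    classical
    have h0 : Nat.find hex ≠ 0 := by
      intro h0
      have := Nat.find_spec hex
      rw [h0, pow_zero, one_smul] at this
      exact hw this
    obtain ⟨j, hj⟩ := Nat.exists_eq_succ_of_ne_zero h0
    refine ⟨d ^ j • w, Nat.find_min hex (by omega), ?_⟩
    rw [← mul_smul, ← pow_succ', ← Nat.succ_eq_add_one, ← hj]
    exact Nat.find_spec hex
  obtain ⟨γ, hγ, hne⟩ : ∃ γ ∈ nthRootsFinset (m * n) (1 : K), eigProj (m * n) c γ • u ≠ 0 := by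
    by_contra! hall
    exact hu (by rw [← h.sum_eigProj_smul u, Finset.sum_eq_zero hall])
  have hγ' := (mem_nthRootsFinset (Nat.pos_of_ne_zero h.ne_zero) (1 : K)).1 hγ
  have hcv := h.c_eigProj_smul hγ' u
  have hdv : d • eigProj (m * n) c γ • u = 0 := by
    rw [← mul_smul, mul_eigProj_of_mul (s := ξ⁻¹) (by rw [inv_inv, h.d_c]), mul_smul, hdu,
      smul_zero]
  refine ⟨γ, _, ⟨hγ', ?_⟩, hne, hcv, hdv⟩
  set v := eigProj (m * n) c γ • u
  obtain ⟨k, hk⟩ := hM.nilp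
  have h1 : ∀ k : ℕ, (casimir m ξ b c d t - algebraMap K R κ) ^ k • v =
      (ξ ^ m * ρ * (γ ^ m)⁻¹ + γ ^ m - κ) ^ k • v := by
    intro k
    apply pow_smul_of_smul
    rw [sub_smul, h.casimir_smul hM hγ' hcv, hdv, smul_zero, smul_zero, sub_zero,
      algebraMap_smul, sub_smul]
  have h2 := hk v
  rw [h1, smul_eq_zero] at h2
  exact sub_eq_zero.1 (eq_zero_of_pow_eq_zero (h2.resolve_right hne))

/-- A module in a block vanishes as soon as the projection to its highest weights is zero. -/
lemma subsingleton_of_cutProj (h : IsDouble m n ξ F b c d t) (hM : IsBlk m ξ ρ κ b c d t M)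
    (hE : ∀ w : M, cutProj m n ξ ρ κ c • w = 0) : Subsingleton M := by
  by_contra hne
  rw [not_subsingleton_iff_nontrivial] at hne
  obtain ⟨γ, v, hγ, hv, hcv, -⟩ := h.exists_highest hM
  exact hv (by rw [← h.cutProj_smul hγ hcv, hE])

lemma casimir_smul_of_isSimpleModule (h : IsDouble m n ξ F b c d t)
    (hM : IsBlk m ξ ρ κ b c d t M) [IsSimpleModule R M] (w : M) :
    casimir m ξ b c d t • w = κ • w := by
  have := IsSimpleModule.nontrivial R M
  obtain ⟨γ, v, hγ, hv, hcv, hdv⟩ := h.exists_highest hM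
  let N : Submodule R M :=
    { carrier := {w | casimir m ξ b c d t • w = κ • w}
      add_mem' := fun {x y} hx hy => by
        simp only [Set.mem_ofPred_eq] at *
        rw [smul_add, hx, hy, smul_add]
      zero_mem' := by simp
      smul_mem' := fun r x hx => by
        simp only [Set.mem_ofPred_eq] at *
        rw [← mul_smul, h.casimir_central, mul_smul, hx, smul_comm] }
  have hvN : v ∈ N := by
    change casimir m ξ b c d t • v = κ • v
    rw [h.casimir_smul hM hγ.1 hcv, hdv, smul_zero, smul_zero, sub_zero, hγ.2]
  have hN : N = ⊤ := (eq_bot_or_eq_top N).resolve_left fun hb => hv (by simpa [hb] using hvN)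
  have : w ∈ N := hN ▸ Submodule.mem_top
  exact this

/-- If the Casimir element acts on a highest weight vector `v`, and on its `t`-orbit, by a scalar,
then `t ^ n` kills `v`. -/
lemma t_pow_smul_eq_zero (h : IsDouble m n ξ F b c d t) (hM : IsBlk m ξ ρ κ b c d t M)
    (hΩ : ∀ w : M, casimir m ξ b c d t • w = κ • w) {γ : K} {v : M} (hγ : IsCut m n ξ ρ κ γ)
    (hcv : c • v = γ • v) (hdv : d • v = 0) : t ^ n • v = 0 := by
  have hdt : ∀ (w : M) (δ : K), δ ^ (m * n) = 1 → c • w = δ • w → ∃ s : K, d • t • w = s • w := by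
    intro w δ hδ hw
    have h1 := h.casimir_smul' hM hδ hw
    rw [hΩ] at h1
    refine ⟨(ξ ^ m - 1)⁻¹ * (ρ * (δ ^ m)⁻¹ + ξ ^ m * δ ^ m - κ), ?_⟩
    rw [mul_smul, sub_smul, h1, sub_sub_cancel, inv_smul_smul₀ h.q_ne_one]
  have hwt : ∀ j : ℕ, (ξ ^ j * γ) ^ (m * n) = 1 := h.pow_mul_pow hγ.1
  have hdj : ∀ j : ℕ, ∃ s : K, d ^ j • t ^ j • v = s • v := by
    intro j
    induction j with
    | zero => exact ⟨1, by simp⟩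
    | succ j ih =>
      obtain ⟨s, hs⟩ := ih
      obtain ⟨s', hs'⟩ := hdt _ _ (hwt j) (h.c_t_pow_smul hcv j)
      refine ⟨s' * s, ?_⟩
      rw [pow_succ, pow_succ' t, mul_smul, mul_smul, hs', smul_comm, hs, smul_smul]
  have hdj' : ∀ j : ℕ, d ^ (j + 1) • t ^ j • v = 0 := by
    intro j
    obtain ⟨s, hs⟩ := hdj j
    rw [pow_succ', mul_smul, hs, smul_comm, hdv, smul_zero]
  set a := t - F • ((c ^ m - ξ ^ m • b) * d ^ (n - 1)) with ha
  have hn := h.one_lt_n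
  have haj : ∀ j : ℕ, j ≤ n - 1 → a ^ j • v = t ^ j • v := by
    intro j
    induction j with
    | zero => simp
    | succ j ih =>
      intro hj
      have e : n - 1 = n - 1 - (j + 1) + (j + 1) := by omega
      rw [pow_succ' a, mul_smul, ih (by omega), ha, sub_smul, smul_assoc, mul_smul, e, pow_add,
        mul_smul (d ^ _), hdj', smul_zero, smul_zero, smul_zero, sub_zero, pow_succ', mul_smul]
  have hcm : ∀ k : ℕ, c ^ k • v = γ ^ k • v := pow_smul_of_smul hcv
  have hb := h.b_smul hM hγ.1 hcv
  obtain ⟨s, hs⟩ := hdj (n - 1)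
  have h1 : a ^ n • v = (b ^ n - 1) • v := by rw [ha, h.a_pow]
  have e : n = n - 1 + 1 := by omega
  have h2 : a ^ n • v = t ^ n • v - (F * s * (γ ^ m - ξ ^ m * (ρ * (γ ^ m)⁻¹))) • v := by
    conv_lhs => rw [e]
    rw [pow_succ', mul_smul, haj _ le_rfl, ha, sub_smul, ← mul_smul, ← pow_succ', ← e, smul_assoc,
      mul_smul, hs, smul_comm _ s, sub_smul, smul_assoc, hcm, hb]
    congr 1
    module
  rw [h2, sub_smul, pow_smul_of_smul hb, one_smul] at h1
  obtain ⟨l, hl⟩ : ∃ l : K, t ^ n • v = l • v :=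
    ⟨_, (by rw [sub_eq_iff_eq_add.1 h1]; module :
      t ^ n • v = ((ρ * (γ ^ m)⁻¹) ^ n - 1 + F * s * (γ ^ m - ξ ^ m * (ρ * (γ ^ m)⁻¹))) • v)⟩
  refine eq_zero_of_smul (γ := ξ ^ n * γ) (δ := γ) ?_ ?_
  · rw [← h.c_t_pow_smul hcv, hl, smul_comm, hcv, smul_comm]
  · intro heq
    exact h.xi_pow_n_ne_one (mul_right_cancel₀ (h.ne_zero_of_pow hγ.1) (by rw [heq, one_mul]))

/-- The structure of a simple module relative to the highest weights of its block. -/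
lemma simple_structure (h : IsDouble m n ξ F b c d t) (hM : IsBlk m ξ ρ κ b c d t M)
    [IsSimpleModule R M] :
    ∃ v : M, v ≠ 0 ∧ cutProj m n ξ ρ κ c • v = v ∧ d • v = 0 ∧
      (∀ w : M, cutProj m n ξ ρ κ c • t • w = 0) ∧
      ∀ w : M, ∃ k : K, cutProj m n ξ ρ κ c • w = k • v := by
  have := IsSimpleModule.nontrivial R M
  have hΩ := h.casimir_smul_of_isSimpleModule hM
  obtain ⟨γ, v, hγ, hv, hcv, hdv⟩ := h.exists_highest hM
  have htn := h.t_pow_smul_eq_zero hM hΩ hγ hcv hdv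
  have key : ∀ (x : M) (δ : K), c • x = δ • x → d • x = 0 → x = 0 ∨
      powSpan t (K ∙ x) = ⊤ := by
    intro x δ hcx hdx
    obtain ⟨N, hN⟩ := h.exists_submodule_powSpan hM (K ∙ x)
      (fun y hy => by
        obtain ⟨k, rfl⟩ := Submodule.mem_span_singleton.1 hy
        rw [smul_comm, hcx]
        exact Submodule.smul_mem _ _ (Submodule.smul_mem _ _ (Submodule.mem_span_singleton_self x)))
      (fun y hy => by
        obtain ⟨k, rfl⟩ := Submodule.mem_span_singleton.1 hy
        rw [smul_comm, hdx, smul_zero]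
        exact zero_mem _)
    rcases eq_bot_or_eq_top N with hb | ht
    · left
      have : x ∈ N := (hN x).2 (subset_powSpan t _ (Submodule.mem_span_singleton_self x))
      simpa [hb] using this
    · right
      rw [eq_top_iff]
      exact fun y _ => (hN y).1 (ht ▸ Submodule.mem_top)
  have hspan := (key v γ hcv hdv).resolve_left hv
  have hind : ∀ {p : M → Prop}, p 0 → (∀ x y, p x → p y → p (x + y)) →
      (∀ (k : K) x, p x → p (k • x)) → (∀ j, p (t ^ j • v)) → ∀ w, p w := by
    intro p h0 hadd hsm hp w
    have hw : w ∈ powSpan t (K ∙ v) := hspan ▸ Submodule.mem_top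
    induction hw using Submodule.span_induction with
    | mem x hx =>
      obtain ⟨j, y, hy, rfl⟩ := hx
      obtain ⟨k, rfl⟩ := Submodule.mem_span_singleton.1 hy
      rw [smul_comm]
      exact hsm _ _ (hp j)
    | zero => exact h0
    | add x y _ _ hx hy => exact hadd _ _ hx hy
    | smul k x _ hx => exact hsm _ _ hx
  have htn' : ∀ w : M, t ^ n • w = 0 := by
    refine hind (by simp) (fun x y hx hy => by rw [smul_add, hx, hy, add_zero])
      (fun k x hx => by rw [smul_comm, hx, smul_zero]) fun j => ?_
    rw [← mul_smul, ← pow_add, add_comm, pow_add, mul_smul, htn, smul_zero]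
  set L := step m n ξ ρ κ γ with hL
  obtain ⟨hL1, hLc⟩ := h.step_spec hγ
  rw [← hL] at hL1 hLc
  have hdL : d • t ^ L • v = 0 := by
    have hw := h.c_t_pow_smul hcv (L - 1)
    have h1 := h.casimir_smul' hM (h.pow_mul_pow hγ.1 _) hw
    rw [hΩ] at h1
    have hx : ξ ^ m ≠ 0 := pow_ne_zero _ h.xi_ne_zero
    have e : ρ * ((ξ ^ (L - 1) * γ) ^ m)⁻¹ + ξ ^ m * (ξ ^ (L - 1) * γ) ^ m = κ := by
      rw [← hLc.2]
      have : ξ ^ L * γ = ξ * (ξ ^ (L - 1) * γ) := by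
        rw [← mul_assoc, ← pow_succ', Nat.sub_add_cancel hL1]
      rw [this, mul_pow ξ, mul_inv]
      field_simp
    rw [e, ← mul_smul t, ← pow_succ', Nat.sub_add_cancel hL1] at h1
    have h2 : (ξ ^ m - 1) • d • t ^ L • v = 0 := by
      rw [eq_comm, sub_eq_self] at h1
      exact h1
    exact (smul_eq_zero.1 h2).resolve_left h.q_ne_one
  have htL : t ^ L • v = 0 := by
    refine (key _ _ (h.c_t_pow_smul hcv L) hdL).resolve_right fun htop => ?_
    have hsurj : ∀ w : M, ∃ u, w = t • u := by
      intro w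
      have hw : w ∈ powSpan t (K ∙ t ^ L • v) := htop ▸ Submodule.mem_top
      induction hw using Submodule.span_induction with
      | mem x hx =>
        obtain ⟨j, y, hy, rfl⟩ := hx
        obtain ⟨k, rfl⟩ := Submodule.mem_span_singleton.1 hy
        refine ⟨k • t ^ (j + (L - 1)) • v, ?_⟩
        rw [smul_comm t, smul_comm _ k, ← mul_smul, ← mul_smul, ← pow_add, ← pow_succ', add_assoc,
          Nat.sub_add_cancel hL1]
      | zero => exact ⟨0, by simp⟩
      | add x y _ _ hx hy =>
        obtain ⟨x', rfl⟩ := hx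
        obtain ⟨y', rfl⟩ := hy
        exact ⟨x' + y', by rw [smul_add]⟩
      | smul k x _ hx =>
        obtain ⟨x', rfl⟩ := hx
        exact ⟨k • x', by rw [smul_comm]⟩
    have hsurj' : ∀ (j : ℕ) (w : M), ∃ u, w = t ^ j • u := by
      intro j
      induction j with
      | zero => exact fun w => ⟨w, by simp⟩
      | succ j ih =>
        intro w
        obtain ⟨u, hu⟩ := ih w
        obtain ⟨u', rfl⟩ := hsurj u
        exact ⟨u', by rw [hu, pow_succ, mul_smul]⟩
    obtain ⟨u, hu⟩ := hsurj' n v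
    exact hv (by rw [hu, htn'])
  have hEt : ∀ j, cutProj m n ξ ρ κ c • t ^ (j + 1) • v = 0 := by
    intro j
    by_cases hj : j + 1 < L
    · exact h.cutProj_smul_of_not (h.pow_mul_pow hγ.1 _) (not_isCut_of_lt_step (by omega) hj)
        (h.c_t_pow_smul hcv _)
    · have e : j + 1 = (j + 1 - L) + L := by omega
      rw [e, pow_add, mul_smul, htL, smul_zero, smul_zero]
  refine ⟨v, hv, h.cutProj_smul hγ hcv, hdv, ?_, ?_⟩
  · refine hind (by simp) (fun x y hx hy => by rw [smul_add, smul_add, hx, hy, add_zero])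
      (fun k x hx => by rw [smul_comm t, smul_comm, hx, smul_zero]) fun j => ?_
    rw [← mul_smul t, ← pow_succ']
    exact hEt j
  · refine hind ⟨0, by simp⟩ ?_ ?_ ?_
    · rintro x y ⟨k, hk⟩ ⟨l, hl⟩
      exact ⟨k + l, by rw [smul_add, hk, hl, add_smul]⟩
    · rintro l x ⟨k, hk⟩
      exact ⟨l * k, by rw [smul_comm, hk, smul_smul]⟩
    · rintro (_ | j)
      · exact ⟨1, by rw [pow_zero, one_smul, one_smul, h.cutProj_smul hγ hcv]⟩
      · exact ⟨0, by rw [hEt, zero_smul]⟩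

/-- The sum of the highest weight spaces of a module in a block. -/
def cutSpace (m n : ℕ) (ξ ρ κ : K) (c : R) (M : Type) [AddCommGroup M] [Module K M] [Module R M]
    [IsScalarTower K R M] : Submodule K M :=
  LinearMap.range (Algebra.lsmul K K M (cutProj m n ξ ρ κ c))

lemma mem_cutSpace (h : IsDouble m n ξ F b c d t) {w : M} :
    w ∈ cutSpace m n ξ ρ κ c M ↔ cutProj m n ξ ρ κ c • w = w := by
  constructor
  · rintro ⟨u, rfl⟩
    exact h.cutProj_cutProj_smul u
  · intro hw
    exact ⟨w, hw⟩

lemma finrank_cutSpace (h : IsDouble m n ξ F b c d t) [FiniteDimensional K M]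
    (N : Submodule R M) :
    Module.finrank K (cutSpace m n ξ ρ κ c M) =
      Module.finrank K (cutSpace m n ξ ρ κ c N) +
        Module.finrank K (cutSpace m n ξ ρ κ c (M ⧸ N)) := by
  let φ : cutSpace m n ξ ρ κ c M →ₗ[K] cutSpace m n ξ ρ κ c (M ⧸ N) :=
    (N.mkQ.restrictScalars K).restrict (fun w hw => by
      rw [h.mem_cutSpace] at hw ⊢
      rw [LinearMap.restrictScalars_apply, ← map_smul, hw])
  let i : cutSpace m n ξ ρ κ c N →ₗ[K] cutSpace m n ξ ρ κ c M :=
    (N.subtype.restrictScalars K).restrict (fun w hw => by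
      rw [h.mem_cutSpace] at hw ⊢
      rw [LinearMap.restrictScalars_apply, ← map_smul, hw])
  have hi : Function.Injective i := fun x y hxy =>
    Subtype.ext (Subtype.ext (congrArg (fun z : cutSpace m n ξ ρ κ c M => (z : M)) hxy))
  have hφ : LinearMap.range φ = ⊤ := by
    rw [LinearMap.range_eq_top]
    rintro ⟨w, u, rfl⟩
    obtain ⟨u, rfl⟩ := N.mkQ_surjective u
    exact ⟨⟨cutProj m n ξ ρ κ c • u, u, rfl⟩, Subtype.ext rfl⟩
  have hker : LinearMap.ker φ = LinearMap.range i := by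
    ext w
    constructor
    · intro hw
      have hwN : (w : M) ∈ N := by
        have := congrArg Subtype.val (LinearMap.mem_ker.1 hw)
        exact (Submodule.Quotient.mk_eq_zero N).1 this
      refine ⟨⟨⟨w, hwN⟩, ?_⟩, rfl⟩
      rw [h.mem_cutSpace]
      exact Subtype.ext (h.mem_cutSpace.1 w.2)
    · rintro ⟨w, rfl⟩
      refine LinearMap.mem_ker.2 (Subtype.ext ?_)
      exact (Submodule.Quotient.mk_eq_zero N).2 w.1.2
  have h1 := LinearMap.finrank_range_add_finrank_ker φ
  rw [hφ, hker, finrank_top, LinearMap.finrank_range_of_inj hi] at h1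
  omega

/-- The length of a module in a block is the dimension of the sum of its highest weight spaces. -/
lemma length_eq (h : IsDouble m n ξ F b c d t) (k : ℕ) :
    ∀ (M : Type) [AddCommGroup M] [Module K M] [Module R M] [IsScalarTower K R M]
      [FiniteDimensional K M], IsBlk m ξ ρ κ b c d t M → Module.finrank K M ≤ k →
      Module.length R M = Module.finrank K (cutSpace m n ξ ρ κ c M) := by
  induction k with
  | zero =>
    intro M _ _ _ _ _ hM hk
    have : Subsingleton M := Module.finrank_zero_iff.1 (Nat.le_zero.1 hk)
    rw [Module.length_eq_zero, Module.finrank_zero_of_subsingleton, Nat.cast_zero]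
  | succ k ih =>
    intro M _ _ _ _ _ hM hk
    by_cases hs : IsSimpleModule R M
    · obtain ⟨v, hv, hEv, -, -, hEw⟩ := h.simple_structure hM
      rw [Module.length_eq_one, eq_comm]
      have : Module.finrank K (cutSpace m n ξ ρ κ c M) = 1 := by
        refine finrank_eq_one ⟨v, h.mem_cutSpace.2 hEv⟩ (fun h0 => hv (congrArg Subtype.val h0)) ?_
        rintro ⟨w, u, rfl⟩
        obtain ⟨k, hk⟩ := hEw u
        exact ⟨k, Subtype.ext hk.symm⟩
      rw [this, Nat.cast_one]
    · rcases subsingleton_or_nontrivial M with h0 | h0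
      · rw [Module.length_eq_zero, Module.finrank_zero_of_subsingleton, Nat.cast_zero]
      · obtain ⟨N, hN0, hN1⟩ : ∃ N : Submodule R M, N ≠ ⊥ ∧ N ≠ ⊤ := by
          by_contra! hall
          refine hs ((isSimpleModule_iff R M).2 ⟨fun N => ?_⟩)
          by_cases hN : N = ⊥
          · exact Or.inl hN
          · exact Or.inr (hall N hN)
        have hfd : FiniteDimensional K N :=
          Module.Finite.of_injective (N.subtype.restrictScalars K) N.injective_subtype
        have hfin : Module.finrank K N + Module.finrank K (M ⧸ N) = Module.finrank K M := by
          have := Submodule.finrank_quotient_add_finrank (N.restrictScalars K)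
          rw [add_comm]
          exact this
        have hn1 : 0 < Module.finrank K N := by
          have : Nontrivial N := N.nontrivial_iff_ne_bot.2 hN0
          exact Module.finrank_pos
        have hn2 : 0 < Module.finrank K (M ⧸ N) := by
          have : Nontrivial (M ⧸ N) := Submodule.Quotient.nontrivial_iff.2 hN1
          exact Module.finrank_pos
        rw [Module.length_eq_add_of_exact N.subtype N.mkQ N.injective_subtype N.mkQ_surjective
          (LinearMap.exact_subtype_mkQ N), ih N (hM.of_submodule N) (by omega),
          ih (M ⧸ N) (hM.quotient N) (by omega), h.finrank_cutSpace N, Nat.cast_add]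

/-- The action on a sum of simple submodules. -/
lemma smul_of_mem_sSup (h : IsDouble m n ξ F b c d t) (hM : IsBlk m ξ ρ κ b c d t M) {w : M}
    (hw : w ∈ sSup {N : Submodule R M | IsSimpleModule R N}) :
    casimir m ξ b c d t • w = κ • w ∧ d • cutProj m n ξ ρ κ c • w = 0 ∧
      cutProj m n ξ ρ κ c • t • w = 0 := by
  rw [sSup_eq_iSup'] at hw
  refine Submodule.iSup_induction (fun N : {N : Submodule R M | IsSimpleModule R N} => N.1)
    (motive := fun w => casimir m ξ b c d t • w = κ • w ∧ d • cutProj m n ξ ρ κ c • w = 0 ∧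
      cutProj m n ξ ρ κ c • t • w = 0) hw ?_ (by simp) fun x y hx hy => by
    simp only [smul_add, hx.1, hx.2.1, hx.2.2, hy.1, hy.2.1, hy.2.2, add_zero, and_self]
  rintro ⟨N, hN'⟩ x hx
  have : IsSimpleModule R N := hN'
  have hN := hM.of_submodule N
  obtain ⟨v, -, -, hdv, hEt, hE⟩ := h.simple_structure hN
  refine ⟨congrArg Subtype.val (h.casimir_smul_of_isSimpleModule hN ⟨x, hx⟩), ?_,
    congrArg Subtype.val (hEt ⟨x, hx⟩)⟩
  obtain ⟨k, hk⟩ := hE ⟨x, hx⟩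
  have : d • cutProj m n ξ ρ κ c • (⟨x, hx⟩ : N) = 0 := by
    rw [hk, smul_comm, hdv, smul_zero]
  exact congrArg Subtype.val this

/-- The next highest weight. -/
def shiftFun (h : IsDouble m n ξ F b c d t) (γ : cutset m n ξ ρ κ) : cutset m n ξ ρ κ :=
  ⟨ξ ^ step m n ξ ρ κ γ * γ,
    (mem_cutset h.ne_zero).2 (h.step_spec ((mem_cutset h.ne_zero).1 γ.2)).2⟩

lemma shiftFun_injective (h : IsDouble m n ξ F b c d t) :
    Function.Injective (h.shiftFun (ρ := ρ) (κ := κ)) := by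
  have key : ∀ γ δ : cutset m n ξ ρ κ, step m n ξ ρ κ γ ≤ step m n ξ ρ κ δ →
      ξ ^ step m n ξ ρ κ γ * (γ : K) = ξ ^ step m n ξ ρ κ δ * δ → γ = δ := by
    intro γ δ hle heq
    have hγ := (mem_cutset h.ne_zero).1 γ.2
    have h1 := (h.step_spec hγ).1
    obtain ⟨j, hj⟩ := Nat.exists_eq_add_of_le hle
    rw [hj, pow_add, mul_assoc] at heq
    have h2 := mul_left_cancel₀ (pow_ne_zero _ h.xi_ne_zero) heq
    rcases Nat.eq_zero_or_pos j with rfl | hpos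
    · exact Subtype.ext (by simpa using h2)
    · exact absurd (h2 ▸ hγ) (not_isCut_of_lt_step hpos (by omega))
  intro γ δ hγδ
  have heq := congrArg Subtype.val hγδ
  rcases le_total (step m n ξ ρ κ γ) (step m n ξ ρ κ δ) with hle | hle
  · exact key γ δ hle heq
  · exact (key δ γ hle heq.symm).symm

/-- The permutation of the highest weights of a block which maps each one to the next. -/
def shift (h : IsDouble m n ξ F b c d t) : Equiv.Perm (cutset m n ξ ρ κ) :=
  Equiv.ofBijective _ (Finite.injective_iff_bijective.1 (h.shiftFun_injective (ρ := ρ) (κ := κ)))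

lemma shift_apply (h : IsDouble m n ξ F b c d t) (γ : cutset m n ξ ρ κ) :
    (h.shift γ : K) = ξ ^ step m n ξ ρ κ γ * γ := rfl

lemma shift_symm_apply (h : IsDouble m n ξ F b c d t) (γ : cutset m n ξ ρ κ) :
    (γ : K) = ξ ^ step m n ξ ρ κ (h.shift.symm γ) * h.shift.symm γ := by
  rw [← h.shift_apply, Equiv.apply_symm_apply]

/-- The operator acting by `x γ` on the weight space of every highest weight `γ`, and by zero on
the other weight spaces. -/
def wtOp (m n : ℕ) (ξ ρ κ : K) (c : R) (x : cutset m n ξ ρ κ → R) : R :=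
  ∑ γ : cutset m n ξ ρ κ, x γ * eigProj (m * n) c (γ : K)

lemma isCut_coe (h : IsDouble m n ξ F b c d t) (γ : cutset m n ξ ρ κ) : IsCut m n ξ ρ κ γ :=
  (mem_cutset h.ne_zero).1 γ.2

lemma wtOp_smul (h : IsDouble m n ξ F b c d t) (x : cutset m n ξ ρ κ → R)
    (γ : cutset m n ξ ρ κ) {w : M} (hw : c • w = (γ : K) • w) :
    wtOp m n ξ ρ κ c x • w = x γ • w := by
  classical
  rw [wtOp, Finset.sum_smul, Finset.sum_eq_single γ]
  · rw [mul_smul, eigProj_smul h.prim (Nat.pos_of_ne_zero h.ne_zero) (h.isCut_coe γ).1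
      (h.isCut_coe γ).1 hw, if_pos rfl]
  · intro δ _ hne
    rw [mul_smul, eigProj_smul h.prim (Nat.pos_of_ne_zero h.ne_zero) (h.isCut_coe γ).1
      (h.isCut_coe δ).1 hw, if_neg (fun h' => hne (Subtype.ext h')), smul_zero]
  · intro h'
    exact absurd (Finset.mem_univ γ) h'

lemma wtOp_smul_of_not (h : IsDouble m n ξ F b c d t) (x : cutset m n ξ ρ κ → R) {γ : K}
    (hγ' : γ ^ (m * n) = 1) (hγ : ¬ IsCut m n ξ ρ κ γ) {w : M} (hw : c • w = γ • w) :
    wtOp m n ξ ρ κ c x • w = 0 := by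
  classical
  rw [wtOp, Finset.sum_smul]
  refine Finset.sum_eq_zero fun δ _ => ?_
  rw [mul_smul, eigProj_smul h.prim (Nat.pos_of_ne_zero h.ne_zero) hγ' (h.isCut_coe δ).1 hw,
    if_neg, smul_zero]
  rintro rfl
  exact hγ (h.isCut_coe δ)

/-- If `x γ` maps weight `γ` to weight `σ γ`, then the operator intertwines the projections. -/
lemma wtOp_eigProj_smul (h : IsDouble m n ξ F b c d t) (x : cutset m n ξ ρ κ → R)
    (σ : Equiv.Perm (cutset m n ξ ρ κ))
    (hx : ∀ (γ : cutset m n ξ ρ κ) (w : M), c • w = (γ : K) • w →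
      c • x γ • w = (σ γ : K) • x γ • w) (γ : cutset m n ξ ρ κ) (w : M) :
    wtOp m n ξ ρ κ c x • eigProj (m * n) c (γ : K) • w =
      eigProj (m * n) c (σ γ : K) • wtOp m n ξ ρ κ c x • w := by
  classical
  have hpos := Nat.pos_of_ne_zero h.ne_zero
  refine h.weight_induction (p := fun w : M => wtOp m n ξ ρ κ c x • eigProj (m * n) c (γ : K) • w =
      eigProj (m * n) c (σ γ : K) • wtOp m n ξ ρ κ c x • w) (by simp)
    (fun v w hv hw => by simp only [smul_add, hv, hw]) (fun δ w hδ hw => ?_) w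
  rw [eigProj_smul h.prim hpos hδ (h.isCut_coe γ).1 hw]
  by_cases hcut : IsCut m n ξ ρ κ δ
  · obtain ⟨δ, rfl⟩ : ∃ δ' : cutset m n ξ ρ κ, (δ' : K) = δ :=
      ⟨⟨δ, (mem_cutset h.ne_zero).2 hcut⟩, rfl⟩
    rw [h.wtOp_smul x δ hw, eigProj_smul h.prim hpos (h.isCut_coe _).1 (h.isCut_coe _).1
      (hx δ w hw)]
    by_cases heq : γ = δ
    · rw [if_pos (by rw [heq]), if_pos (by rw [heq]), h.wtOp_smul x δ hw]
    · rw [if_neg (fun h' => heq (Subtype.ext h')),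
        if_neg (fun h' => heq (σ.injective (Subtype.ext h'))), smul_zero]
  · rw [h.wtOp_smul_of_not x hδ hcut hw, smul_zero, if_neg, smul_zero]
    rintro rfl
    exact hcut (h.isCut_coe γ)

lemma cutProj_wtOp_smul (h : IsDouble m n ξ F b c d t) (x : cutset m n ξ ρ κ → R)
    (σ : Equiv.Perm (cutset m n ξ ρ κ))
    (hx : ∀ (γ : cutset m n ξ ρ κ) (w : M), c • w = (γ : K) • w →
      c • x γ • w = (σ γ : K) • x γ • w) (w : M) :
    cutProj m n ξ ρ κ c • wtOp m n ξ ρ κ c x • w = wtOp m n ξ ρ κ c x • w := by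
  refine h.weight_induction (p := fun w : M =>
      cutProj m n ξ ρ κ c • wtOp m n ξ ρ κ c x • w = wtOp m n ξ ρ κ c x • w) (by simp)
    (fun v w hv hw => by simp only [smul_add, hv, hw]) (fun δ w hδ hw => ?_) w
  by_cases hcut : IsCut m n ξ ρ κ δ
  · obtain ⟨δ, rfl⟩ : ∃ δ' : cutset m n ξ ρ κ, (δ' : K) = δ :=
      ⟨⟨δ, (mem_cutset h.ne_zero).2 hcut⟩, rfl⟩
    rw [h.wtOp_smul x δ hw, h.cutProj_smul (h.isCut_coe (σ δ)) (hx δ w hw)]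
  · rw [h.wtOp_smul_of_not x hδ hcut hw, smul_zero]

/-- The operator moving each highest weight space up to the next one. -/
def raise (m n : ℕ) (ξ ρ κ : K) (c t : R) : R :=
  wtOp m n ξ ρ κ c fun γ => t ^ step m n ξ ρ κ γ

/-- The operator moving each highest weight space down to the previous one. -/
def lower (h : IsDouble m n ξ F b c d t) (ρ κ : K) : R :=
  wtOp m n ξ ρ κ c fun γ => d ^ step m n ξ ρ κ (h.shift.symm γ)

lemma raise_weight (h : IsDouble m n ξ F b c d t) (γ : cutset m n ξ ρ κ) (w : M)
    (hw : c • w = (γ : K) • w) :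
    c • t ^ step m n ξ ρ κ γ • w = (h.shift γ : K) • t ^ step m n ξ ρ κ γ • w :=
  h.c_t_pow_smul hw _

lemma lower_weight (h : IsDouble m n ξ F b c d t) (γ : cutset m n ξ ρ κ) (w : M)
    (hw : c • w = (γ : K) • w) :
    c • d ^ step m n ξ ρ κ (h.shift.symm γ) • w =
      (h.shift.symm γ : K) • d ^ step m n ξ ρ κ (h.shift.symm γ) • w := by
  rw [h.c_d_pow_smul hw]
  congr 1
  conv_lhs => rw [h.shift_symm_apply γ]
  rw [← mul_assoc, ← mul_pow, inv_mul_cancel₀ h.xi_ne_zero, one_pow, one_mul]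

/-- Below the next highest weight, vectors can be recovered from their images under powers
of `d`. -/
lemma exists_eq_smul_t_pow (h : IsDouble m n ξ F b c d t) (hM : IsBlk m ξ ρ κ b c d t M)
    (S : Submodule R M) (hΩ : ∀ w ∈ S, casimir m ξ b c d t • w = κ • w) {γ : K}
    (hγ : IsCut m n ξ ρ κ γ) (j : ℕ) (hj : j < step m n ξ ρ κ γ) {w : M} (hw : w ∈ S)
    (hcw : c • w = (ξ ^ j * γ) • w) : ∃ k : K, w = k • t ^ j • d ^ j • w := by
  induction j generalizing w with
  | zero => exact ⟨1, by simp⟩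
  | succ j ih =>
    have hcd : c • d • w = (ξ ^ j * γ) • d • w := by
      rw [h.c_d_smul hcw, pow_succ', mul_assoc, inv_mul_cancel_left₀ h.xi_ne_zero]
    obtain ⟨k, hk⟩ := ih (by omega) (S.smul_mem d hw) hcd
    have hδ := h.pow_mul_pow hγ.1 (j + 1)
    have h1 := h.casimir_smul hM hδ hcw
    rw [hΩ w hw] at h1
    set s := ξ ^ m * ρ * ((ξ ^ (j + 1) * γ) ^ m)⁻¹ + (ξ ^ (j + 1) * γ) ^ m with hs
    have hne : s - κ ≠ 0 := fun h0 =>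
      not_isCut_of_lt_step (Nat.le_add_left 1 j) hj ⟨hδ, sub_eq_zero.1 h0⟩
    refine ⟨(s - κ)⁻¹ * (ξ ^ m - 1) * k, ?_⟩
    have h2 : (s - κ) • w = (ξ ^ m - 1) • t • d • w := by
      rw [sub_smul, h1, sub_sub_cancel]
    rw [pow_succ' t, pow_succ d, mul_smul t, mul_smul _ d, mul_smul, smul_comm k, ← hk, mul_smul,
      ← h2, inv_smul_smul₀ hne]

/-- A family of highest weight vectors stable under raising and lowering is the highest weight
part of a submodule. -/
lemma exists_submodule_of_stable (h : IsDouble m n ξ F b c d t) (hM : IsBlk m ξ ρ κ b c d t M)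
    (S : Submodule R M) (hΩ : ∀ w ∈ S, casimir m ξ b c d t • w = κ • w)
    (hSt : ∀ w ∈ S, cutProj m n ξ ρ κ c • t • w = 0)
    (hMd : ∀ w : M, d • cutProj m n ξ ρ κ c • w ∈ S)
    (hMt : ∀ w : M, cutProj m n ξ ρ κ c • t • w ∈ S)
    (V : Submodule K M) (hVE : ∀ v ∈ V, cutProj m n ξ ρ κ c • v = v)
    (hVe : ∀ (γ : cutset m n ξ ρ κ), ∀ v ∈ V, eigProj (m * n) c (γ : K) • v ∈ V)
    (hVr : ∀ v ∈ V, raise m n ξ ρ κ c t • v ∈ V) (hVl : ∀ v ∈ V, h.lower ρ κ • v ∈ V) :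
    ∃ N : Submodule R M, (∀ v ∈ V, v ∈ N) ∧ ∀ w ∈ N, cutProj m n ξ ρ κ c • w ∈ V := by
  have hsum : ∀ v ∈ V, v = ∑ γ : cutset m n ξ ρ κ, eigProj (m * n) c (γ : K) • v := by
    intro v hv
    conv_lhs => rw [← hVE v hv, cutProj, Finset.sum_smul]
    exact (Finset.sum_coe_sort (cutset m n ξ ρ κ) fun γ => eigProj (m * n) c γ • v).symm
  have hwt : ∀ (γ : cutset m n ξ ρ κ) (v : M),
      c • eigProj (m * n) c (γ : K) • v = (γ : K) • eigProj (m * n) c (γ : K) • v :=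
    fun γ v => h.c_eigProj_smul (h.isCut_coe γ).1 v
  obtain ⟨N, hN⟩ := h.exists_submodule_powSpan hM V
    (fun v hv => by
      rw [hsum v hv, Finset.smul_sum]
      refine Submodule.sum_mem _ fun γ _ => ?_
      rw [hwt]
      exact Submodule.smul_mem _ _ (hVe γ v hv))
    (fun v hv => by
      rw [hsum v hv, Finset.smul_sum]
      refine Submodule.sum_mem _ fun γ _ => ?_
      set w := eigProj (m * n) c (γ : K) • v with hw
      have hwV : w ∈ V := hVe γ v hv
      have hdw : d • w ∈ S := by
        rw [← hVE w hwV]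
        exact hMd w
      set L := step m n ξ ρ κ (h.shift.symm γ) with hL
      have hL1 : 1 ≤ L := (h.step_spec (h.isCut_coe (h.shift.symm γ))).1
      have hcdw : c • d • w = (ξ ^ (L - 1) * (h.shift.symm γ : K)) • d • w := by
        rw [h.c_d_smul (hwt γ v)]
        congr 1
        conv_lhs => rw [h.shift_symm_apply γ, ← hL, ← Nat.sub_add_cancel hL1, pow_succ', mul_assoc,
          inv_mul_cancel_left₀ h.xi_ne_zero]
      obtain ⟨k, hk⟩ := h.exists_eq_smul_t_pow hM S hΩ (h.isCut_coe (h.shift.symm γ)) (L - 1)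
        (by omega) hdw hcdw
      rw [hk]
      refine Submodule.smul_mem _ _ (Submodule.subset_span ⟨L - 1, _, ?_, rfl⟩)
      rw [← mul_smul, ← pow_succ, Nat.sub_add_cancel hL1]
      have := hVl w hwV
      rwa [lower, h.wtOp_smul _ γ (hwt γ v)] at this)
  refine ⟨N, fun v hv => (hN v).2 (subset_powSpan t V hv), fun w hw => ?_⟩
  rw [hN] at hw
  induction hw using Submodule.span_induction with
  | mem x hx =>
    obtain ⟨j, v, hv, rfl⟩ := hx
    rw [hsum v hv, Finset.smul_sum, Finset.smul_sum]
    refine Submodule.sum_mem _ fun γ _ => ?_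
    set w := eigProj (m * n) c (γ : K) • v with hw
    have hwV : w ∈ V := hVe γ v hv
    have hraise : t ^ step m n ξ ρ κ γ • w ∈ V := by
      have := hVr w hwV
      rwa [raise, h.wtOp_smul _ γ (hwt γ v)] at this
    obtain ⟨hL1, hLc⟩ := h.step_spec (h.isCut_coe γ)
    rcases Nat.eq_zero_or_pos j with rfl | hj0
    · rw [pow_zero, one_smul, hVE w hwV]
      exact hwV
    · rcases lt_trichotomy j (step m n ξ ρ κ γ) with hj | rfl | hj
      · rw [h.cutProj_smul_of_not (h.pow_mul_pow (h.isCut_coe γ).1 j)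
          (not_isCut_of_lt_step hj0 hj) (h.c_t_pow_smul (hwt γ v) j)]
        exact zero_mem _
      · rw [hVE _ hraise]
        exact hraise
      · have hS : t ^ step m n ξ ρ κ γ • w ∈ S := by
          rw [← hVE _ hraise]
          conv => rw [← Nat.sub_add_cancel hL1, pow_succ', mul_smul]
          exact hMt _
        have e : j = 1 + (j - step m n ξ ρ κ γ - 1) + step m n ξ ρ κ γ := by omega
        rw [e, pow_add, pow_add, mul_smul, mul_smul, pow_one, hSt _ (S.smul_mem _ hS)]
        exact zero_mem _
  | zero => simp
  | add x y _ _ hx hy => rw [smul_add]; exact add_mem hx hy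
  | smul k x _ hx => rw [smul_comm]; exact Submodule.smul_mem _ _ hx

/-- Two complementary families of highest weight vectors as in `exists_submodule_of_stable` give a
direct sum decomposition. -/
lemma isCompl_of_stable (h : IsDouble m n ξ F b c d t) (hM : IsBlk m ξ ρ κ b c d t M)
    {V₁ V₂ : Submodule K M} (hV : Disjoint V₁ V₂)
    (htop : ∀ w : M, cutProj m n ξ ρ κ c • w ∈ V₁ ⊔ V₂) {N₁ N₂ : Submodule R M}
    (h₁ : ∀ v ∈ V₁, v ∈ N₁) (h₁' : ∀ w ∈ N₁, cutProj m n ξ ρ κ c • w ∈ V₁)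
    (h₂ : ∀ v ∈ V₂, v ∈ N₂) (h₂' : ∀ w ∈ N₂, cutProj m n ξ ρ κ c • w ∈ V₂) : IsCompl N₁ N₂ := by
  constructor
  · rw [disjoint_iff]
    have hs : Subsingleton (N₁ ⊓ N₂ : Submodule R M) := by
      refine h.subsingleton_of_cutProj (hM.of_submodule _) fun w => Subtype.ext ?_
      exact Submodule.disjoint_def.1 hV _ (h₁' _ w.2.1) (h₂' _ w.2.2)
    exact Submodule.subsingleton_iff_eq_bot.1 hs
  · rw [codisjoint_iff]
    have hs : Subsingleton (M ⧸ N₁ ⊔ N₂) := by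
      refine h.subsingleton_of_cutProj (hM.quotient _) fun w => ?_
      obtain ⟨w, rfl⟩ := (N₁ ⊔ N₂).mkQ_surjective w
      rw [← map_smul]
      refine (Submodule.Quotient.mk_eq_zero _).2 ?_
      obtain ⟨x, hx, y, hy, hxy⟩ := Submodule.mem_sup.1 (htop w)
      rw [← hxy]
      exact Submodule.add_mem_sup (h₁ x hx) (h₂ y hy)
    exact Submodule.Quotient.subsingleton_iff.1 hs

lemma exists_isCompl_c (h : IsDouble m n ξ F b c d t) [FiniteDimensional K M]
    (S : Submodule R M) : ∃ S' : Submodule K M, (∀ v ∈ S', c • v ∈ S') ∧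
      IsCompl (S.restrictScalars K) S' := by
  have : NeZero (m * n) := ⟨h.ne_zero⟩
  have := h.prim.neZero'
  have hs : (Algebra.lsmul K K M c).IsSemisimple := by
    refine Module.End.isSemisimple_of_squarefree_aeval_eq_zero
      (p := X ^ (m * n) - 1) (X_pow_sub_one_separable_iff.2 (NeZero.ne _)).squarefree ?_
    rw [map_sub, map_pow, aeval_X, map_one, ← map_pow, h.c_pow, map_one, sub_self]
  obtain ⟨S', hS', hc⟩ := Module.End.isSemisimple_iff.1 hs (S.restrictScalars K)
    (fun v hv => S.smul_mem c hv)
  exact ⟨S', fun v hv => hS' hv, hc⟩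

lemma eigProj_smul_mem {S : Submodule K M} (hS : ∀ v ∈ S, c • v ∈ S) (N : ℕ) (γ : K) {v : M}
    (hv : v ∈ S) : eigProj N c γ • v ∈ S := by
  have hpow : ∀ r : ℕ, c ^ r • v ∈ S := by
    intro r
    induction r with
    | zero => simpa using hv
    | succ r ih =>
      rw [pow_succ', mul_smul]
      exact hS _ ih
  rw [eigProj, smul_assoc, Finset.sum_smul]
  refine S.smul_mem _ (S.sum_mem fun r _ => ?_)
  rw [smul_assoc]
  exact S.smul_mem _ (hpow r)

/-- In an indecomposable module of Loewy length two, the dimensions of the highest weight parts of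
the submodule and the quotient differ by at most one. -/
theorem finrank_le_of_indecomposable (h : IsDouble m n ξ F b c d t)
    (hM : IsBlk m ξ ρ κ b c d t M) [FiniteDimensional K M]
    (hind : ∀ N₁ N₂ : Submodule R M, IsCompl N₁ N₂ → N₁ = ⊥ ∨ N₂ = ⊥)
    (S : Submodule R M) (hΩ : ∀ w ∈ S, casimir m ξ b c d t • w = κ • w)
    (hSd : ∀ w ∈ S, d • cutProj m n ξ ρ κ c • w = 0)
    (hSt : ∀ w ∈ S, cutProj m n ξ ρ κ c • t • w = 0)
    (hMd : ∀ w : M, d • cutProj m n ξ ρ κ c • w ∈ S)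
    (hMt : ∀ w : M, cutProj m n ξ ρ κ c • t • w ∈ S) :
    Module.finrank K (cutSpace m n ξ ρ κ c (M ⧸ S)) ≤
        Module.finrank K (cutSpace m n ξ ρ κ c S) + 1 ∧
      Module.finrank K (cutSpace m n ξ ρ κ c S) ≤
        Module.finrank K (cutSpace m n ξ ρ κ c (M ⧸ S)) + 1 := by
  classical
  obtain ⟨S', hcS', hSS'⟩ := h.exists_isCompl_c S
  have hcS : ∀ v ∈ S.restrictScalars K, c • v ∈ S.restrictScalars K := fun v hv => S.smul_mem c hv
  have hES : ∀ v ∈ S.restrictScalars K, cutProj m n ξ ρ κ c • v ∈ S.restrictScalars K :=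
    fun v hv => S.smul_mem _ hv
  have hES' : ∀ v ∈ S', cutProj m n ξ ρ κ c • v ∈ S' := by
    intro v hv
    rw [cutProj, Finset.sum_smul]
    exact S'.sum_mem fun γ _ => eigProj_smul_mem hcS' _ γ hv
  have hEe : ∀ (γ : cutset m n ξ ρ κ) (w : M), cutProj m n ξ ρ κ c • eigProj (m * n) c (γ : K) • w =
      eigProj (m * n) c (γ : K) • w := fun γ w =>
    h.cutProj_smul (h.isCut_coe γ) (h.c_eigProj_smul (h.isCut_coe γ).1 w)
  have hee : ∀ (γ δ : cutset m n ξ ρ κ) (w : M), eigProj (m * n) c (γ : K) •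
      eigProj (m * n) c (δ : K) • w = if γ = δ then eigProj (m * n) c (δ : K) • w else 0 := by
    intro γ δ w
    rw [eigProj_smul h.prim (Nat.pos_of_ne_zero h.ne_zero) (h.isCut_coe δ).1 (h.isCut_coe γ).1
      (h.c_eigProj_smul (h.isCut_coe δ).1 w)]
    simp only [Subtype.ext_iff]
  -- the two highest weight parts
  set C := cutSpace m n ξ ρ κ c M with hC
  have hmC : ∀ w, w ∈ C ↔ cutProj m n ξ ρ κ c • w = w := fun w => h.mem_cutSpace
  let U : Submodule K M := S' ⊓ C
  let W : Submodule K M := S.restrictScalars K ⊓ C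
  have heU : ∀ (γ : cutset m n ξ ρ κ), ∀ v ∈ U, Algebra.lsmul K K M (eigProj (m * n) c (γ : K)) v ∈ U :=
    fun γ v hv => ⟨eigProj_smul_mem hcS' _ _ hv.1, (hmC _).2 (hEe γ v)⟩
  have heW : ∀ (γ : cutset m n ξ ρ κ), ∀ v ∈ W, Algebra.lsmul K K M (eigProj (m * n) c (γ : K)) v ∈ W :=
    fun γ v hv => ⟨S.smul_mem _ hv.1, (hmC _).2 (hEe γ v)⟩
  -- the operators `raise` and `lower`
  have hup : ∀ (γ : cutset m n ξ ρ κ) (v : M), c • v = (γ : K) • v →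
      t ^ step m n ξ ρ κ γ • v = cutProj m n ξ ρ κ c • t • t ^ (step m n ξ ρ κ γ - 1) • v := by
    intro γ v hv
    have hstep := (h.step_spec (h.isCut_coe γ)).1
    rw [← mul_smul t, ← pow_succ', Nat.sub_add_cancel hstep,
      h.cutProj_smul (h.isCut_coe (h.shift γ)) (h.raise_weight γ v hv)]
  have hdown : ∀ (γ : cutset m n ξ ρ κ) (v : M), c • v = (γ : K) • v →
      d ^ step m n ξ ρ κ (h.shift.symm γ) • v =
        d ^ (step m n ξ ρ κ (h.shift.symm γ) - 1) • d • cutProj m n ξ ρ κ c • v := by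
    intro γ v hv
    have hstep := (h.step_spec (h.isCut_coe (h.shift.symm γ))).1
    rw [← mul_smul _ d, ← pow_succ, Nat.sub_add_cancel hstep, h.cutProj_smul (h.isCut_coe γ) hv]
  have hce : ∀ (γ : cutset m n ξ ρ κ) (w : M), c • eigProj (m * n) c (γ : K) • w =
      (γ : K) • eigProj (m * n) c (γ : K) • w := fun γ w => h.c_eigProj_smul (h.isCut_coe γ).1 w
  have hrS : ∀ w : M, raise m n ξ ρ κ c t • w ∈ S := by
    intro w
    rw [raise, wtOp, Finset.sum_smul]
    refine S.sum_mem fun γ _ => ?_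
    rw [mul_smul, hup γ _ (hce γ w)]
    exact hMt _
  have hlS : ∀ w : M, h.lower ρ κ • w ∈ S := by
    intro w
    rw [lower, wtOp, Finset.sum_smul]
    refine S.sum_mem fun γ _ => ?_
    rw [mul_smul, hdown γ _ (hce γ w)]
    exact S.smul_mem _ (hMd _)
  have hr0 : ∀ w ∈ S, raise m n ξ ρ κ c t • w = 0 := by
    intro w hw
    rw [raise, wtOp, Finset.sum_smul]
    refine Finset.sum_eq_zero fun γ _ => ?_
    rw [mul_smul, hup γ _ (hce γ w)]
    exact hSt _ (S.smul_mem _ (S.smul_mem _ hw))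
  have hl0 : ∀ w ∈ S, h.lower ρ κ • w = 0 := by
    intro w hw
    rw [lower, wtOp, Finset.sum_smul]
    refine Finset.sum_eq_zero fun γ _ => ?_
    rw [mul_smul, hdown γ _ (hce γ w), hSd _ (S.smul_mem _ hw), smul_zero]
  have hrW : ∀ v ∈ U, Algebra.lsmul K K M (raise m n ξ ρ κ c t) v ∈ W := fun v _ =>
    ⟨hrS v, (hmC _).2 (h.cutProj_wtOp_smul _ h.shift h.raise_weight v)⟩
  have hlW : ∀ v ∈ U, Algebra.lsmul K K M (h.lower ρ κ) v ∈ W := fun v _ =>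
    ⟨hlS v, (hmC _).2 (h.cutProj_wtOp_smul _ h.shift.symm h.lower_weight v)⟩
  let pU : cutset m n ξ ρ κ → U →ₗ[K] U := fun γ => (Algebra.lsmul K K M _).restrict (heU γ)
  let pW : cutset m n ξ ρ κ → W →ₗ[K] W := fun γ => (Algebra.lsmul K K M _).restrict (heW γ)
  let f : U →ₗ[K] W := (Algebra.lsmul K K M _).restrict hrW
  let g : U →ₗ[K] W := (Algebra.lsmul K K M _).restrict hlW
  have hsum : ∀ w ∈ C, ∑ γ : cutset m n ξ ρ κ, eigProj (m * n) c (γ : K) • w = w := by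
    intro w hw
    conv_rhs => rw [← (hmC w).1 hw, cutProj, Finset.sum_smul]
    exact Finset.sum_coe_sort (cutset m n ξ ρ κ) fun γ => eigProj (m * n) c γ • w
  have hpU : IsProjFamily pU := by
    refine ⟨fun γ u => Subtype.ext ?_, fun γ δ u hne => Subtype.ext ?_, fun u => Subtype.ext ?_⟩
    · exact (hee γ γ u).trans (if_pos rfl)
    · exact (hee γ δ u).trans (if_neg hne)
    · rw [Submodule.coe_sum]
      exact hsum u u.2.2
  have hpW : IsProjFamily pW := by
    refine ⟨fun γ u => Subtype.ext ?_, fun γ δ u hne => Subtype.ext ?_, fun u => Subtype.ext ?_⟩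
    · exact (hee γ γ u).trans (if_pos rfl)
    · exact (hee γ δ u).trans (if_neg hne)
    · rw [Submodule.coe_sum]
      exact hsum u u.2.2
  have hf : ∀ γ u, f (pU γ u) = pW (h.shift γ) (f u) := fun γ u =>
    Subtype.ext (h.wtOp_eigProj_smul _ h.shift h.raise_weight γ (u : M))
  have hg : ∀ γ u, g (pU γ u) = pW (h.shift.symm γ) (g u) := fun γ u =>
    Subtype.ext (h.wtOp_eigProj_smul _ h.shift.symm h.lower_weight γ (u : M))
  have hUW : Disjoint U W := hSS'.symm.disjoint.mono inf_le_left inf_le_left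
  have hUWC : U ⊔ W = C := by
    refine le_antisymm (sup_le inf_le_right inf_le_right) fun w hw => ?_
    obtain ⟨x, hx, y, hy, hxy⟩ := Submodule.mem_sup.1
      (show w ∈ S.restrictScalars K ⊔ S' from hSS'.sup_eq_top ▸ Submodule.mem_top)
    rw [← (hmC w).1 hw, ← hxy, smul_add, add_comm]
    exact Submodule.add_mem_sup ⟨hES' y hy, ⟨y, rfl⟩⟩ ⟨hES x hx, ⟨x, rfl⟩⟩
  have hdec : ¬ Decomposes pU pW f g := by
    rintro ⟨U₁, U₂, W₁, W₂, hU, hW, hs₁, hs₂, hn₁, hn₂⟩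
    let V : Submodule K U → Submodule K W → Submodule K M := fun U' W' =>
      U'.map U.subtype ⊔ W'.map W.subtype
    have hst : ∀ (U' : Submodule K U) (W' : Submodule K W), IsSubpair pU pW f g U' W' →
        ∃ N : Submodule R M, (∀ v ∈ V U' W', v ∈ N) ∧
          ∀ w ∈ N, cutProj m n ξ ρ κ c • w ∈ V U' W' := by
      intro U' W' hs
      have hel : ∀ {p : M → Prop}, (∀ x y, p x → p y → p (x + y)) → (∀ u ∈ U', p (u : U)) →
          (∀ w ∈ W', p (w : W)) → ∀ v ∈ V U' W', p v := by
        intro p hadd hpu hpw v hv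
        obtain ⟨_, ⟨u, hu, rfl⟩, _, ⟨w, hw, rfl⟩, rfl⟩ := Submodule.mem_sup.1 hv
        exact hadd _ _ (hpu u hu) (hpw w hw)
      have hWV : ∀ w ∈ W', (w : M) ∈ V U' W' := fun w hw =>
        Submodule.mem_sup_right ⟨w, hw, rfl⟩
      have hUV : ∀ u ∈ U', (u : M) ∈ V U' W' := fun u hu =>
        Submodule.mem_sup_left ⟨u, hu, rfl⟩
      refine h.exists_submodule_of_stable hM S hΩ hSt hMd hMt (V U' W') ?_ ?_ ?_ ?_
      · exact hel (fun x y hx hy => by rw [smul_add, hx, hy]) (fun u _ => (hmC _).1 u.2.2)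
          fun w _ => (hmC _).1 w.2.2
      · intro γ
        exact hel (fun x y hx hy => by rw [smul_add]; exact add_mem hx hy)
          (fun u hu => hUV _ (hs.1 γ u hu)) fun w hw => hWV _ (hs.2.1 γ w hw)
      · exact hel (fun x y hx hy => by rw [smul_add]; exact add_mem hx hy)
          (fun u hu => hWV _ (hs.2.2.1 u hu)) fun w _ => by rw [hr0 _ w.2.1]; exact zero_mem _
      · exact hel (fun x y hx hy => by rw [smul_add]; exact add_mem hx hy)
          (fun u hu => hWV _ (hs.2.2.2 u hu)) fun w _ => by rw [hl0 _ w.2.1]; exact zero_mem _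
    obtain ⟨N₁, h₁, h₁'⟩ := hst U₁ W₁ hs₁
    obtain ⟨N₂, h₂, h₂'⟩ := hst U₂ W₂ hs₂
    have hVd : Disjoint (V U₁ W₁) (V U₂ W₂) := by
      rw [Submodule.disjoint_def]
      intro v hv₁ hv₂
      obtain ⟨_, ⟨u₁, hu₁, rfl⟩, _, ⟨w₁, hw₁, rfl⟩, rfl⟩ := Submodule.mem_sup.1 hv₁
      obtain ⟨_, ⟨u₂, hu₂, rfl⟩, _, ⟨w₂, hw₂, rfl⟩, heq⟩ := Submodule.mem_sup.1 hv₂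
      simp only [Submodule.subtype_apply] at heq ⊢
      have hz : (u₂ - u₁ : M) = w₁ - w₂ := by
        rw [sub_eq_sub_iff_add_eq_add, heq, add_comm]
      have h0 := Submodule.disjoint_def.1 hUW _ (U.sub_mem u₂.2 u₁.2)
        (by rw [hz]; exact W.sub_mem w₁.2 w₂.2)
      have hu : u₂ = u₁ := Subtype.ext (sub_eq_zero.1 h0)
      have hw : w₁ = w₂ := Subtype.ext (sub_eq_zero.1 (hz.symm.trans h0))
      have hu0 : u₁ = 0 := Submodule.disjoint_def.1 hU.disjoint _ hu₁ (hu ▸ hu₂)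
      have hw0 : w₁ = 0 := Submodule.disjoint_def.1 hW.disjoint _ hw₁ (hw ▸ hw₂)
      rw [hu0, hw0]
      simp
    have htop : ∀ w : M, cutProj m n ξ ρ κ c • w ∈ V U₁ W₁ ⊔ V U₂ W₂ := by
      intro w
      have hw : cutProj m n ξ ρ κ c • w ∈ U ⊔ W := hUWC ▸ ⟨w, rfl⟩
      obtain ⟨x, hx, y, hy, hxy⟩ := Submodule.mem_sup.1 hw
      rw [← hxy]
      obtain ⟨x₁, hx₁, x₂, hx₂, hx⟩ := Submodule.mem_sup.1
        (show (⟨x, hx⟩ : U) ∈ U₁ ⊔ U₂ from hU.sup_eq_top ▸ Submodule.mem_top)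
      obtain ⟨y₁, hy₁, y₂, hy₂, hy⟩ := Submodule.mem_sup.1
        (show (⟨y, hy⟩ : W) ∈ W₁ ⊔ W₂ from hW.sup_eq_top ▸ Submodule.mem_top)
      have ex : (x₁ + x₂ : M) = x := congrArg Subtype.val hx
      have ey : (y₁ + y₂ : M) = y := congrArg Subtype.val hy
      rw [← ex, ← ey, add_add_add_comm]
      exact Submodule.add_mem_sup (Submodule.add_mem_sup ⟨x₁, hx₁, rfl⟩ ⟨y₁, hy₁, rfl⟩)
        (Submodule.add_mem_sup ⟨x₂, hx₂, rfl⟩ ⟨y₂, hy₂, rfl⟩)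
    have hne : ∀ (U' : Submodule K U) (W' : Submodule K W) (N : Submodule R M),
        (∀ v ∈ V U' W', v ∈ N) → (U' ≠ ⊥ ∨ W' ≠ ⊥) → N ≠ ⊥ := by
      rintro U' W' N hN hn rfl
      rcases hn with hn | hn
      · obtain ⟨x, hx, hx0⟩ := Submodule.exists_mem_ne_zero_of_ne_bot hn
        exact hx0 (Subtype.ext (by simpa using hN x (Submodule.mem_sup_left ⟨x, hx, rfl⟩)))
      · obtain ⟨x, hx, hx0⟩ := Submodule.exists_mem_ne_zero_of_ne_bot hn
        exact hx0 (Subtype.ext (by simpa using hN x (Submodule.mem_sup_right ⟨x, hx, rfl⟩)))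
    rcases hind N₁ N₂ (h.isCompl_of_stable hM hVd htop h₁ h₁' h₂ h₂') with hb | hb
    · exact hne U₁ W₁ N₁ h₁ hn₁ hb
    · exact hne U₂ W₂ N₂ h₂ hn₂ hb
  have hfW : Module.finrank K W = Module.finrank K (cutSpace m n ξ ρ κ c S) := by
    let i : cutSpace m n ξ ρ κ c S →ₗ[K] M :=
      (S.subtype.restrictScalars K).comp (cutSpace m n ξ ρ κ c S).subtype
    have hi : Function.Injective i := fun x y hxy => Subtype.ext (Subtype.ext hxy)
    have hW : W = LinearMap.range i := by
      ext w
      constructor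
      · rintro ⟨hw, hw'⟩
        exact ⟨⟨⟨w, hw⟩, h.mem_cutSpace.2 (Subtype.ext ((hmC w).1 hw'))⟩, rfl⟩
      · rintro ⟨w, rfl⟩
        exact ⟨w.1.2, (hmC _).2 (congrArg Subtype.val (h.mem_cutSpace.1 w.2))⟩
    rw [hW, LinearMap.finrank_range_of_inj hi]
  have hfin := h.finrank_cutSpace (ρ := ρ) (κ := κ) S
  rw [← hC] at hfin
  have hfUW := Submodule.finrank_sup_add_finrank_inf_eq U W
  rw [hUW.eq_bot, finrank_bot, hUWC] at hfUW
  constructor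
  · by_contra hlt
    exact hdec (decomposes_of_lt_left _ U W pU pW f g h.shift h.shift.symm hpU hpW hf hg le_rfl
      (by omega))
  · by_contra hlt
    exact hdec (decomposes_of_lt_right _ U W pU pW f g h.shift h.shift.symm hpU hpW hf hg le_rfl
      (by omega))

/-- A central element acts on an indecomposable module with a single generalised eigenvalue. -/
lemma _root_.Radford.exists_central_smul_eq_zero [IsAlgClosed K] [FiniteDimensional K M]
    [Nontrivial M] (hind : ∀ N₁ N₂ : Submodule R M, IsCompl N₁ N₂ → N₁ = ⊥ ∨ N₂ = ⊥) {z : R}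
    (hz : ∀ r, z * r = r * z) :
    ∃ (κ : K) (k : ℕ), ∀ w : M, (z - algebraMap K R κ) ^ k • w = 0 := by
  have : IsNoetherian R M := isNoetherian_of_tower K inferInstance
  have : IsArtinian R M := isArtinian_of_tower K inferInstance
  obtain ⟨κ, hκ⟩ := Module.End.exists_eigenvalue (Algebra.lsmul K K M z)
  obtain ⟨v, hv⟩ := hκ.exists_hasEigenvector
  have hv' : (z - algebraMap K R κ) • v = 0 := by
    rw [sub_smul, algebraMap_smul, sub_eq_zero]
    exact hv.apply_eq_smul
  let f : M →ₗ[R] M :=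
    { toFun := fun w => (z - algebraMap K R κ) • w
      map_add' := fun x y => smul_add _ x y
      map_smul' := fun r x => by
        simp only [RingHom.id_apply]
        rw [← mul_smul, ← mul_smul, sub_mul, mul_sub, hz, Algebra.commutes] }
  have hf : ∀ (k : ℕ) (w : M), (f ^ k) w = (z - algebraMap K R κ) ^ k • w := by
    intro k
    induction k with
    | zero => simp
    | succ k ih =>
      intro w
      rw [pow_succ', Module.End.mul_apply, ih, pow_succ', mul_smul]
      rfl
  obtain ⟨k, hk, hk1⟩ := (f.eventually_isCompl_ker_pow_range_pow.and
    (Filter.eventually_ge_atTop 1)).exists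
  refine ⟨κ, k, fun w => ?_⟩
  rcases hind _ _ hk with h0 | h0
  · refine absurd ((Submodule.mem_bot R).1 (h0 ▸ ?_)) hv.2
    rw [LinearMap.mem_ker, hf, ← Nat.sub_add_cancel hk1, pow_succ, mul_smul, hv', smul_zero]
  · rw [← hf]
    exact (Submodule.mem_bot R).1 (h0 ▸ ⟨w, rfl⟩)

/-- An indecomposable module lies in a block. -/
lemma exists_isBlk (h : IsDouble m n ξ F b c d t) [IsAlgClosed K] [FiniteDimensional K M]
    [Nontrivial M] (hb : b ^ (m * n) = 1)
    (hind : ∀ N₁ N₂ : Submodule R M, IsCompl N₁ N₂ → N₁ = ⊥ ∨ N₂ = ⊥) :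
    ∃ ρ κ : K, IsBlk m ξ ρ κ b c d t M := by
  obtain ⟨κ, hκ⟩ := exists_central_smul_eq_zero (K := K) hind h.casimir_central
  obtain ⟨ρ, k, hρ⟩ := exists_central_smul_eq_zero (K := K) hind h.bc_central
  refine ⟨ρ, κ, fun w => ?_, hκ⟩
  have : NeZero (m * n) := ⟨h.ne_zero⟩
  have := h.prim.neZero'
  have hz : (b * c ^ m) ^ (m * n) = 1 := by
    rw [(Commute.pow_right (show Commute b c from h.b_c) m).mul_pow, hb, one_mul, ← pow_mul,
      mul_comm, pow_mul, h.c_pow, one_pow]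
  have hs : (Algebra.lsmul K K M (b * c ^ m)).IsSemisimple := by
    refine Module.End.isSemisimple_of_squarefree_aeval_eq_zero
      (p := X ^ (m * n) - 1) (X_pow_sub_one_separable_iff.2 (NeZero.ne _)).squarefree ?_
    rw [map_sub, map_pow, aeval_X, map_one, ← map_pow, hz, map_one, sub_self]
  have hmem : w ∈ (Algebra.lsmul K K M (b * c ^ m)).genEigenspace ρ k := by
    rw [Module.End.mem_genEigenspace_nat, LinearMap.mem_ker]
    have : Algebra.lsmul K K M (b * c ^ m) - ρ • 1 =
        Algebra.lsmul K K M (b * c ^ m - algebraMap K R ρ) := by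
      rw [map_sub, AlgHom.commutes, Algebra.algebraMap_eq_smul_one]
    rw [this, ← map_pow]
    exact hρ w
  by_cases hk : k = 0
  · have h0 := hρ w
    rw [hk, pow_zero, one_smul] at h0
    rw [h0, smul_zero, smul_zero]
  · rw [hs.isFinitelySemisimple.genEigenspace_eq_eigenspace ρ
      (by exact_mod_cast Nat.pos_of_ne_zero hk)] at hmem
    exact Module.End.mem_eigenspace_iff.1 hmem

/-- In an indecomposable module whose quotient by the socle is semisimple, the lengths of the socle
and of the quotient differ by at most one. -/
theorem length_socle_le (h : IsDouble m n ξ F b c d t) [IsAlgClosed K] [FiniteDimensional K M]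
    [Nontrivial M] (hb : b ^ (m * n) = 1)
    (hind : ∀ N₁ N₂ : Submodule R M, IsCompl N₁ N₂ → N₁ = ⊥ ∨ N₂ = ⊥)
    (hss : IsSemisimpleModule R (M ⧸ sSup {N : Submodule R M | IsSimpleModule R N})) :
    Module.length R (M ⧸ sSup {N : Submodule R M | IsSimpleModule R N}) ≤
        Module.length R (sSup {N : Submodule R M | IsSimpleModule R N} : Submodule R M) + 1 ∧
      Module.length R (sSup {N : Submodule R M | IsSimpleModule R N} : Submodule R M) ≤
        Module.length R (M ⧸ sSup {N : Submodule R M | IsSimpleModule R N}) + 1 := by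
  obtain ⟨ρ, κ, hM⟩ := h.exists_isBlk hb hind
  set S := sSup {N : Submodule R M | IsSimpleModule R N} with hS
  have : FiniteDimensional K S :=
    Module.Finite.of_injective (S.subtype.restrictScalars K) S.injective_subtype
  have : FiniteDimensional K (M ⧸ S) :=
    Module.Finite.of_surjective (S.mkQ.restrictScalars K) S.mkQ_surjective
  rw [h.length_eq _ (M ⧸ S) (hM.quotient S) le_rfl, h.length_eq _ S (hM.of_submodule S) le_rfl]
  have hsoc : ∀ w ∈ S, _ := fun w hw => h.smul_of_mem_sSup hM hw
  have hquo : ∀ w : M ⧸ S, _ := fun w => h.smul_of_mem_sSup (hM.quotient S) (w := w)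
    (IsSemisimpleModule.sSup_simples_eq_top R (M ⧸ S) ▸ Submodule.mem_top)
  exact_mod_cast h.finrank_le_of_indecomposable hM hind S (fun w hw => (hsoc w hw).1)
    (fun w hw => (hsoc w hw).2.1) (fun w hw => (hsoc w hw).2.2)
    (fun w => (Submodule.Quotient.mk_eq_zero S).1 (hquo (S.mkQ w)).2.1)
    fun w => (Submodule.Quotient.mk_eq_zero S).1 (hquo (S.mkQ w)).2.2

/-- The relations of the double, in terms of the original generator `a`. -/
lemma of_rel {ξ F : K} {a b c d : R} (hm : 1 < m) (hn : 1 < n) (hξ : IsPrimitiveRoot ξ (m * n))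
    (a_pow : a ^ n = b ^ n - 1) (c_pow : c ^ (m * n) = 1) (d_pow : d ^ n = 0)
    (a_b : a * b = ξ ^ m • (b * a)) (d_c : d * c = ξ • (c * d)) (b_c : b * c = c * b)
    (b_d : b * d = ξ ^ m • (d * b)) (a_d : a * d - d * a = b - c ^ m)
    (a_c : a * c = ξ⁻¹ • (c * a) +
      ((ξ⁻¹ - ξ ^ (n - 1)) * F) • ((c ^ (m + 1) - ξ ^ m • (b * c)) * d ^ (n - 1)))
    (gen : Algebra.adjoin K {b, c, d, a} = ⊤) :
    IsDouble m n ξ F b c d (a + F • ((c ^ m - ξ ^ m • b) * d ^ (n - 1))) := by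
  have hξ0 : ξ ≠ 0 := hξ.ne_zero (Nat.mul_ne_zero (by omega) (by omega))
  have hq0 : ξ ^ m ≠ 0 := pow_ne_zero _ hξ0
  have hqn : ξ ^ m * (ξ ^ m) ^ (n - 1) = 1 := by
    rw [← pow_succ', Nat.sub_add_cancel (by omega), ← pow_mul, hξ.pow_eq_one]
  have hdc : ∀ k, d ^ k * c = ξ ^ k • (c * d ^ k) := by
    intro k
    induction k with
    | zero => simp
    | succ k ih =>
      rw [pow_succ, mul_assoc, d_c, mul_smul_comm, ← mul_assoc, ih, smul_mul_assoc, mul_assoc,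
        smul_smul, ← pow_succ']
  have hdcm : ∀ k, d * c ^ k = ξ ^ k • (c ^ k * d) := by
    intro k
    induction k with
    | zero => simp
    | succ k ih =>
      rw [pow_succ, ← mul_assoc, ih, smul_mul_assoc, mul_assoc, d_c, mul_smul_comm, mul_assoc,
        smul_smul, ← pow_succ]
  have hbd : ∀ k, b * d ^ k = (ξ ^ m) ^ k • (d ^ k * b) := by
    intro k
    induction k with
    | zero => simp
    | succ k ih =>
      rw [pow_succ, ← mul_assoc, ih, smul_mul_assoc, mul_assoc, b_d, mul_smul_comm, mul_assoc,
        smul_smul, ← pow_succ]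
  have hbcm : b * c ^ m = c ^ m * b := Commute.pow_right (show Commute b c from b_c) m
  have hDb : d ^ (n - 1) * b = ξ ^ m • (b * d ^ (n - 1)) := by
    rw [hbd, smul_smul, hqn, one_smul]
  have hdb : d * b = (ξ ^ m)⁻¹ • (b * d) := by
    rw [b_d, inv_smul_smul₀ hq0]
  have hdn : d * d ^ (n - 1) = 0 := by
    rw [← pow_succ', Nat.sub_add_cancel (by omega), d_pow]
  have hdn' : d ^ (n - 1) * d = 0 := by
    rw [← pow_succ, Nat.sub_add_cancel (by omega), d_pow]
  refine ⟨hm, hn, hξ, c_pow, d_pow, b_c, ?_, ?_, d_c, b_d, ?_, ?_, ?_⟩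
  · have hxb : (c ^ m - ξ ^ m • b) * b = b * (c ^ m - ξ ^ m • b) := by
      rw [sub_mul, mul_sub, hbcm, smul_mul_assoc, mul_smul_comm]
    rw [add_mul, a_b, smul_mul_assoc, mul_assoc, hDb, mul_smul_comm, ← mul_assoc, hxb, mul_assoc,
      mul_add, mul_smul_comm, smul_add, smul_comm F]
  · have hcx : (c ^ (m + 1) - ξ ^ m • (b * c)) * d ^ (n - 1) =
        c * ((c ^ m - ξ ^ m • b) * d ^ (n - 1)) := by
      rw [← mul_assoc, mul_sub, ← pow_succ', mul_smul_comm, b_c]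
    have hxc : (c ^ m - ξ ^ m • b) * d ^ (n - 1) * c =
        ξ ^ (n - 1) • (c * ((c ^ m - ξ ^ m • b) * d ^ (n - 1))) := by
      rw [mul_assoc, hdc, mul_smul_comm, ← hcx, ← mul_assoc, sub_mul, ← pow_succ, smul_mul_assoc]
    rw [add_mul, a_c, smul_mul_assoc, hxc, hcx, mul_add, mul_smul_comm]
    generalize c * ((c ^ m - ξ ^ m • b) * d ^ (n - 1)) = y
    rw [add_assoc, smul_add, smul_inv_smul₀ hξ0, smul_smul, ← add_smul, smul_smul]
    congr 2
    field_simp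
    ring
  · have hdx : d * (c ^ m - ξ ^ m • b) = (ξ ^ m • c ^ m - b) * d := by
      rw [mul_sub, hdcm, mul_smul_comm, hdb, smul_inv_smul₀ hq0, sub_mul, smul_mul_assoc]
    rw [add_mul, mul_add, smul_mul_assoc, mul_smul_comm, mul_assoc, hdn', ← mul_assoc d, hdx,
      mul_assoc _ d, hdn, mul_zero, mul_zero, smul_zero, add_zero, add_zero, a_d]
  · rw [add_sub_cancel_right, a_pow]
  · rw [eq_top_iff, ← gen, Algebra.adjoin_le_iff]
    set A := Algebra.adjoin K {b, c, d, a + F • ((c ^ m - ξ ^ m • b) * d ^ (n - 1))} with hA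
    have hbA : b ∈ A := Algebra.subset_adjoin (by simp)
    have hcA : c ∈ A := Algebra.subset_adjoin (by simp)
    have hdA : d ∈ A := Algebra.subset_adjoin (by simp)
    have htA : a + F • ((c ^ m - ξ ^ m • b) * d ^ (n - 1)) ∈ A := Algebra.subset_adjoin (by simp)
    have haA := A.sub_mem htA (A.smul_mem (A.mul_mem (A.sub_mem (A.pow_mem hcA m)
      (A.smul_mem hbA (ξ ^ m))) (A.pow_mem hdA (n - 1))) F)
    rw [add_sub_cancel_right] at haA
    rintro x (rfl | rfl | rfl | rfl) <;> assumption

/-- Adjoining an integral element which almost normalises a finite dimensional subalgebra. -/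
lemma _root_.Radford.fg_adjoin_insert {s : Set R} {a : R}
    (hs : (Subalgebra.toSubmodule (Algebra.adjoin K s)).FG) (hai : IsIntegral K a)
    (hx : ∀ x ∈ s, ∃ u ∈ Algebra.adjoin K s, ∃ v ∈ Algebra.adjoin K s, a * x = u + v * a) :
    (Subalgebra.toSubmodule (Algebra.adjoin K (insert a s))).FG := by
  set T := Algebra.adjoin K s with hT
  set A := Algebra.adjoin K {a} with hA
  have haA : a ∈ A := Algebra.self_mem_adjoin_singleton K a
  have hTx : ∀ x ∈ T, ∃ u ∈ T, ∃ v ∈ T, a * x = u + v * a := by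
    intro x hxT
    induction hxT using Algebra.adjoin_induction with
    | mem x hxs => exact hx x hxs
    | algebraMap r =>
      exact ⟨0, T.zero_mem, algebraMap K R r, T.algebraMap_mem r, by
        rw [zero_add, Algebra.commutes]⟩
    | add x y _ _ ihx ihy =>
      obtain ⟨u, hu, v, hv, h1⟩ := ihx
      obtain ⟨u', hu', v', hv', h2⟩ := ihy
      exact ⟨u + u', T.add_mem hu hu', v + v', T.add_mem hv hv', by rw [mul_add, h1, h2]; noncomm_ring⟩
    | mul x y hxT hyT ihx ihy =>
      obtain ⟨u, hu, v, hv, h1⟩ := ihx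
      obtain ⟨u', hu', v', hv', h2⟩ := ihy
      exact ⟨u * y + v * u', T.add_mem (T.mul_mem hu hyT) (T.mul_mem hv hu'), v * v',
        T.mul_mem hv hv', by
          rw [← mul_assoc, h1, add_mul, mul_assoc v a, h2, mul_add, add_assoc, mul_assoc v v']⟩
  have hfg := hs.mul hai.fg_adjoin_singleton
  set X := Subalgebra.toSubmodule T * Subalgebra.toSubmodule A with hX
  have hTX : ∀ x ∈ T, ∀ w ∈ X, x * w ∈ X := by
    intro x hxT w hw
    induction hw using Submodule.mul_induction_on' with
    | mem_mul_mem y hy z hz =>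
      rw [← mul_assoc]
      exact Submodule.mul_mem_mul (T.mul_mem hxT hy) hz
    | add y _ z _ ihy ihz => rw [mul_add]; exact X.add_mem ihy ihz
  have haX : ∀ w ∈ X, a * w ∈ X := by
    intro w hw
    induction hw using Submodule.mul_induction_on' with
    | mem_mul_mem y hy z hz =>
      obtain ⟨u, hu, v, hv, h1⟩ := hTx y hy
      rw [← mul_assoc, h1, add_mul, mul_assoc]
      exact X.add_mem (Submodule.mul_mem_mul hu hz) (Submodule.mul_mem_mul hv (A.mul_mem haA hz))
    | add y _ z _ ihy ihz => rw [mul_add]; exact X.add_mem ihy ihz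
  have hle : ∀ x ∈ Algebra.adjoin K (insert a s), ∀ w ∈ X, x * w ∈ X := by
    intro x hx'
    induction hx' using Algebra.adjoin_induction with
    | mem x hxs =>
      rcases hxs with rfl | hxs
      · exact haX
      · exact hTX x (Algebra.subset_adjoin hxs)
    | algebraMap r => exact fun w hw => hTX _ (T.algebraMap_mem r) w hw
    | add x y _ _ ihx ihy => exact fun w hw => by rw [add_mul]; exact X.add_mem (ihx w hw) (ihy w hw)
    | mul x y _ _ ihx ihy => exact fun w hw => by rw [mul_assoc]; exact ihx _ (ihy w hw)
  have h1 : (1 : R) ∈ X := by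
    simpa using Submodule.mul_mem_mul (M := Subalgebra.toSubmodule T)
      (N := Subalgebra.toSubmodule A) T.one_mem A.one_mem
  have heq : X = Subalgebra.toSubmodule (Algebra.adjoin K (insert a s)) := by
    refine le_antisymm (Submodule.mul_le.2 fun x hx' y hy => ?_) fun x hx' => ?_
    · exact (Algebra.adjoin K (insert a s)).mul_mem
        (Algebra.adjoin_mono (Set.subset_insert a s) hx')
        (Algebra.adjoin_mono (Set.singleton_subset_iff.2 (Set.mem_insert a s)) hy)
    · simpa using hle x hx' 1 h1
  rw [← heq]
  exact hfg

end IsDouble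

end Double

section Socle

variable {R M : Type} [Ring R] [AddCommGroup M] [Module R M]

lemma isSemisimpleModule_of_jacobson_smul [IsArtinianRing R]
    (h : ∀ r ∈ Ring.jacobson R, ∀ w : M, r • w = 0) : IsSemisimpleModule R M := by
  have hM : Module.IsTorsionBySet R M (Ring.jacobson R) := fun w r => h r r.2 w
  let _ := hM.module
  exact hM.isSemisimpleModule_iff.1 inferInstance

lemma le_sSup_simples (N : Submodule R M) [IsSemisimpleModule R N] :
    N ≤ sSup {N : Submodule R M | IsSimpleModule R N} := by
  have htop := congrArg (Submodule.map N.subtype) (IsSemisimpleModule.sSup_simples_eq_top R N)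
  rw [Submodule.map_top, Submodule.range_subtype, sSup_eq_iSup', Submodule.map_iSup] at htop
  rw [← htop]
  refine iSup_le fun P => le_sSup ?_
  have : IsSimpleModule R P.1 := P.2
  exact IsSimpleModule.congr (Submodule.equivMapOfInjective _ N.injective_subtype P.1).symm

end Socle

section Presentation

variable (𝕜 : Type) [Field 𝕜] (m n : ℕ) (ξ : 𝕜)

/-- The quotient map from the free algebra. -/
def toH : FreeAlgebra 𝕜 (Fin 4) →ₐ[𝕜] H 𝕜 m n ξ := RingQuot.mkAlgHom 𝕜 (HRel 𝕜 m n ξ)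

lemma toH_surjective : Function.Surjective (toH 𝕜 m n ξ) := RingQuot.mkAlgHom_surjective 𝕜 _

lemma toH_rel {x y : FreeAlgebra 𝕜 (Fin 4)} (h : HRel 𝕜 m n ξ x y) :
    toH 𝕜 m n ξ x = toH 𝕜 m n ξ y := RingQuot.mkAlgHom_rel 𝕜 h

lemma toH_fgen (k : Fin 4) : toH 𝕜 m n ξ (fgen 𝕜 k) = gen 𝕜 m n ξ k := rfl

lemma adjoin_gen : Algebra.adjoin 𝕜
    {gen 𝕜 m n ξ 1, gen 𝕜 m n ξ 2, gen 𝕜 m n ξ 3, gen 𝕜 m n ξ 0} = ⊤ := by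
  have hr : Set.range (gen 𝕜 m n ξ) ⊆
      {gen 𝕜 m n ξ 1, gen 𝕜 m n ξ 2, gen 𝕜 m n ξ 3, gen 𝕜 m n ξ 0} := by
    rintro _ ⟨k, rfl⟩
    fin_cases k <;> simp
  rw [eq_top_iff]
  refine le_trans ?_ (Algebra.adjoin_mono hr)
  rw [← AlgHom.range_eq_top (toH 𝕜 m n ξ) |>.2 (toH_surjective 𝕜 m n ξ), ← Algebra.map_top,
    ← FreeAlgebra.adjoin_range_ι, AlgHom.map_adjoin, ← Set.range_comp]
  exact le_rfl

lemma gen_b_pow : gen 𝕜 m n ξ 1 ^ (m * n) = 1 := by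
  simpa only [map_pow, map_one, toH_fgen] using toH_rel 𝕜 m n ξ HRel.bPow

lemma gen_c_pow : gen 𝕜 m n ξ 2 ^ (m * n) = 1 := by
  simpa only [map_pow, map_one, toH_fgen] using toH_rel 𝕜 m n ξ HRel.cPow

lemma gen_d_pow : gen 𝕜 m n ξ 3 ^ n = 0 := by
  simpa only [map_pow, map_zero, toH_fgen] using toH_rel 𝕜 m n ξ HRel.dPow

lemma gen_a_pow : gen 𝕜 m n ξ 0 ^ n = gen 𝕜 m n ξ 1 ^ n - 1 := by
  simpa only [map_pow, map_sub, map_one, toH_fgen] using toH_rel 𝕜 m n ξ HRel.aPow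

lemma gen_a_b : gen 𝕜 m n ξ 0 * gen 𝕜 m n ξ 1 = ξ ^ m • (gen 𝕜 m n ξ 1 * gen 𝕜 m n ξ 0) := by
  simpa only [map_mul, map_smul, toH_fgen] using toH_rel 𝕜 m n ξ HRel.ab

lemma gen_d_c : gen 𝕜 m n ξ 3 * gen 𝕜 m n ξ 2 = ξ • (gen 𝕜 m n ξ 2 * gen 𝕜 m n ξ 3) := by
  simpa only [map_mul, map_smul, toH_fgen] using toH_rel 𝕜 m n ξ HRel.dc

lemma gen_b_c : gen 𝕜 m n ξ 1 * gen 𝕜 m n ξ 2 = gen 𝕜 m n ξ 2 * gen 𝕜 m n ξ 1 := by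
  simpa only [map_mul, toH_fgen] using toH_rel 𝕜 m n ξ HRel.bc

lemma gen_b_d : gen 𝕜 m n ξ 1 * gen 𝕜 m n ξ 3 = ξ ^ m • (gen 𝕜 m n ξ 3 * gen 𝕜 m n ξ 1) := by
  simpa only [map_mul, map_smul, toH_fgen] using toH_rel 𝕜 m n ξ HRel.bd

lemma gen_a_d : gen 𝕜 m n ξ 0 * gen 𝕜 m n ξ 3 - gen 𝕜 m n ξ 3 * gen 𝕜 m n ξ 0 =
    gen 𝕜 m n ξ 1 - gen 𝕜 m n ξ 2 ^ m := by
  simpa only [map_mul, map_sub, map_pow, toH_fgen] using toH_rel 𝕜 m n ξ HRel.ad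

lemma gen_a_c : gen 𝕜 m n ξ 0 * gen 𝕜 m n ξ 2 = ξ⁻¹ • (gen 𝕜 m n ξ 2 * gen 𝕜 m n ξ 0) +
    ((ξ⁻¹ - ξ ^ (n - 1)) * (qFact 𝕜 (ξ ^ m) (n - 1))⁻¹) •
      ((gen 𝕜 m n ξ 2 ^ (m + 1) - ξ ^ m • (gen 𝕜 m n ξ 1 * gen 𝕜 m n ξ 2)) *
        gen 𝕜 m n ξ 3 ^ (n - 1)) := by
  simpa only [map_mul, map_sub, map_add, map_smul, map_pow, toH_fgen, div_eq_mul_inv] using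
    toH_rel 𝕜 m n ξ HRel.ac

variable {m n} {ξ}

lemma exists_isDouble (hm : 1 < m) (hn : 1 < n) (hξ : IsPrimitiveRoot ξ (m * n)) :
    ∃ (F : 𝕜) (t : H 𝕜 m n ξ),
      IsDouble m n ξ F (gen 𝕜 m n ξ 1) (gen 𝕜 m n ξ 2) (gen 𝕜 m n ξ 3) t :=
  ⟨_, _, IsDouble.of_rel hm hn hξ (gen_a_pow 𝕜 m n ξ) (gen_c_pow 𝕜 m n ξ) (gen_d_pow 𝕜 m n ξ)
    (gen_a_b 𝕜 m n ξ) (gen_d_c 𝕜 m n ξ) (gen_b_c 𝕜 m n ξ) (gen_b_d 𝕜 m n ξ) (gen_a_d 𝕜 m n ξ)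
    (gen_a_c 𝕜 m n ξ) (adjoin_gen 𝕜 m n ξ)⟩

lemma isIntegral_of_pow_eq_algebraMap {R : Type} [Ring R] [Algebra 𝕜 R] {x : R} {k : ℕ}
    (hk : k ≠ 0) {r : 𝕜} (hx : x ^ k = algebraMap 𝕜 R r) : IsIntegral 𝕜 x :=
  IsIntegral.of_pow (Nat.pos_of_ne_zero hk) (hx ▸ isIntegral_algebraMap)

lemma finite_H (hm : 1 < m) (hn : 1 < n) (hξ : IsPrimitiveRoot ξ (m * n)) :
    Module.Finite 𝕜 (H 𝕜 m n ξ) := by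
  have hN : m * n ≠ 0 := Nat.mul_ne_zero (by omega) (by omega)
  have hq0 : ξ ^ m ≠ 0 := pow_ne_zero _ (hξ.ne_zero hN)
  have hbI : IsIntegral 𝕜 (gen 𝕜 m n ξ 1) :=
    isIntegral_of_pow_eq_algebraMap 𝕜 hN (r := 1) (by rw [gen_b_pow, map_one])
  have hcI : IsIntegral 𝕜 (gen 𝕜 m n ξ 2) :=
    isIntegral_of_pow_eq_algebraMap 𝕜 hN (r := 1) (by rw [gen_c_pow, map_one])
  have hdI : IsIntegral 𝕜 (gen 𝕜 m n ξ 3) :=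
    isIntegral_of_pow_eq_algebraMap 𝕜 (k := n) (by omega) (r := 0) (by rw [gen_d_pow, map_zero])
  have haI : IsIntegral 𝕜 (gen 𝕜 m n ξ 0) := by
    refine ⟨(Polynomial.X ^ n + Polynomial.C 1) ^ m - Polynomial.C 1, ?_, ?_⟩
    · have hp : ((Polynomial.X ^ n + Polynomial.C 1 : Polynomial 𝕜) ^ m).Monic :=
        (Polynomial.monic_X_pow_add_C 1 (by omega)).pow m
      refine hp.sub_of_left (Polynomial.degree_C_le.trans_lt ?_)
      rw [← Polynomial.natDegree_pos_iff_degree_pos, Polynomial.natDegree_pow,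
        Polynomial.natDegree_X_pow_add_C]
      exact Nat.pos_of_ne_zero hN
    · rw [← Polynomial.aeval_def]
      simp only [map_sub, map_pow, map_add, Polynomial.aeval_X, map_one]
      rw [gen_a_pow, sub_add_cancel, ← pow_mul, mul_comm n m, gen_b_pow, sub_self]
  have h1 := hbI.fg_adjoin_singleton
  have h2 := fg_adjoin_insert (a := gen 𝕜 m n ξ 2) h1 hcI (by
    rintro x rfl
    exact ⟨0, zero_mem _, _, Algebra.subset_adjoin rfl, by rw [zero_add, gen_b_c]⟩)
  have h3 := fg_adjoin_insert (a := gen 𝕜 m n ξ 3) h2 hdI (by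
    rintro x (rfl | rfl)
    · exact ⟨0, zero_mem _, _, Subalgebra.smul_mem _ (Algebra.subset_adjoin (Set.mem_insert _ _)) ξ,
        by rw [zero_add, gen_d_c, smul_mul_assoc]⟩
    · refine ⟨0, zero_mem _, (ξ ^ m)⁻¹ • gen 𝕜 m n ξ 1,
        Subalgebra.smul_mem _ (Algebra.subset_adjoin (by simp)) _, ?_⟩
      rw [zero_add, smul_mul_assoc, gen_b_d, inv_smul_smul₀ hq0])
  have h4 := fg_adjoin_insert (a := gen 𝕜 m n ξ 0) h3 haI (by
    set A := Algebra.adjoin 𝕜 {gen 𝕜 m n ξ 3, gen 𝕜 m n ξ 2, gen 𝕜 m n ξ 1} with hA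
    have hbA : gen 𝕜 m n ξ 1 ∈ A := Algebra.subset_adjoin (by simp)
    have hcA : gen 𝕜 m n ξ 2 ∈ A := Algebra.subset_adjoin (by simp)
    have hdA : gen 𝕜 m n ξ 3 ∈ A := Algebra.subset_adjoin (by simp)
    rintro x (rfl | rfl | rfl)
    · exact ⟨_, A.sub_mem hbA (A.pow_mem hcA m), _, hdA, by rw [← gen_a_d, sub_add_cancel]⟩
    · refine ⟨((ξ⁻¹ - ξ ^ (n - 1)) * (qFact 𝕜 (ξ ^ m) (n - 1))⁻¹) •
        ((gen 𝕜 m n ξ 2 ^ (m + 1) - ξ ^ m • (gen 𝕜 m n ξ 1 * gen 𝕜 m n ξ 2)) *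
          gen 𝕜 m n ξ 3 ^ (n - 1)), ?_, ξ⁻¹ • gen 𝕜 m n ξ 2, A.smul_mem hcA _, ?_⟩
      · exact A.smul_mem (A.mul_mem (A.sub_mem (A.pow_mem hcA _) (A.smul_mem (A.mul_mem hbA hcA) _))
          (A.pow_mem hdA _)) _
      · rw [gen_a_c, add_comm, smul_mul_assoc]
    · exact ⟨0, zero_mem _, _, A.smul_mem hbA (ξ ^ m), by
        rw [zero_add, gen_a_b, smul_mul_assoc]⟩)
  have htop : Algebra.adjoin 𝕜
      {gen 𝕜 m n ξ 0, gen 𝕜 m n ξ 3, gen 𝕜 m n ξ 2, gen 𝕜 m n ξ 1} = ⊤ := by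
    rw [eq_top_iff, ← adjoin_gen]
    refine Algebra.adjoin_mono ?_
    rintro x (rfl | rfl | rfl | rfl) <;> simp
  rw [htop, Algebra.top_toSubmodule] at h4
  exact ⟨h4⟩

end Presentation

section Loewy

variable {𝕜 : Type} [Field 𝕜] {m n : ℕ} {ξ : 𝕜} {W : Type} [AddCommGroup W]
  [Module (H 𝕜 m n ξ) W]

lemma jacobson_smul_of_mem_radM (h2 : rad2M 𝕜 m n ξ W = ⊥) {x : W}
    (hx : x ∈ radM 𝕜 m n ξ W) {r : H 𝕜 m n ξ} (hr : r ∈ jrad 𝕜 m n ξ) : r • x = 0 := by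
  induction hx using Submodule.span_induction generalizing r with
  | mem x hx =>
    obtain ⟨s, hs, w, rfl⟩ := hx
    have h : r • s • w ∈ rad2M 𝕜 m n ξ W := Submodule.subset_span ⟨r, hr, s, hs, w, rfl⟩
    rw [h2] at h
    exact (Submodule.mem_bot _).1 h
  | zero => rw [smul_zero]
  | add x y _ _ ihx ihy => rw [smul_add, ihx hr, ihy hr, add_zero]
  | smul s x _ ih =>
    rw [← mul_smul]
    refine ih ?_
    rw [jrad, Ideal.jacobson_bot] at hr ⊢
    exact Ideal.mul_mem_right s _ hr

lemma radM_le_socle [IsArtinianRing (H 𝕜 m n ξ)] (h2 : rad2M 𝕜 m n ξ W = ⊥) :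
    radM 𝕜 m n ξ W ≤ socle 𝕜 m n ξ W := by
  have : IsSemisimpleModule (H 𝕜 m n ξ) (radM 𝕜 m n ξ W) :=
    isSemisimpleModule_of_jacobson_smul fun r hr w => Subtype.ext
      (jacobson_smul_of_mem_radM h2 w.2 (by rwa [jrad, Ideal.jacobson_bot]))
  exact le_sSup_simples _

lemma isSemisimpleModule_quotient_socle [IsArtinianRing (H 𝕜 m n ξ)]
    (h2 : rad2M 𝕜 m n ξ W = ⊥) :
    IsSemisimpleModule (H 𝕜 m n ξ) (W ⧸ socle 𝕜 m n ξ W) := by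
  refine isSemisimpleModule_of_jacobson_smul fun r hr w => ?_
  obtain ⟨w, rfl⟩ := (socle 𝕜 m n ξ W).mkQ_surjective w
  rw [← map_smul]
  refine (Submodule.Quotient.mk_eq_zero _).2 (radM_le_socle h2 (Submodule.subset_span ⟨r, ?_, w, rfl⟩))
  rwa [jrad, Ideal.jacobson_bot]

lemma socle_ne_top (h : LoewyLen2 𝕜 m n ξ W) : socle 𝕜 m n ξ W ≠ ⊤ := by
  intro htop
  have : IsSemisimpleModule (H 𝕜 m n ξ) W := .of_sSup_simples_eq_top htop
  refine h.1 ((Submodule.eq_bot_iff _).2 fun x hx => ?_)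
  refine Submodule.span_induction (p := fun x _ => x = 0) ?_ rfl ?_ ?_ hx
  · rintro _ ⟨r, hr, w, rfl⟩
    rw [jrad, Ideal.jacobson_bot] at hr
    exact Module.mem_annihilator.1 (IsSemisimpleModule.jacobson_le_annihilator _ W hr) w
  · rintro x y _ _ rfl rfl
    rw [add_zero]
  · rintro s x _ rfl
    rw [smul_zero]

lemma socle_ne_bot [IsArtinianRing (H 𝕜 m n ξ)] (h : LoewyLen2 𝕜 m n ξ W) :
    socle 𝕜 m n ξ W ≠ ⊥ := fun hb => h.1 (le_bot_iff.1 (hb ▸ radM_le_socle h.2))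

lemma length_eq_of_lengthIs {k : ℕ} (h : lengthIs 𝕜 m n ξ W k) :
    Module.length (H 𝕜 m n ξ) W = k := by
  obtain ⟨s, h₁, h₂, rfl⟩ := h
  exact (Module.length_compositionSeries s h₁ h₂).symm

lemma exists_lengthIs [IsNoetherian (H 𝕜 m n ξ) W] [IsArtinian (H 𝕜 m n ξ) W] :
    ∃ k, lengthIs 𝕜 m n ξ W k := by
  obtain ⟨s, h₁, h₂⟩ := exists_compositionSeries_of_isNoetherian_isArtinian (H 𝕜 m n ξ) W
  exact ⟨s.length, s, h₁, h₂, rfl⟩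

end Loewy

/-- Proposition 4.5 / Corollary 4.6: if `M` is a finite dimensional
indecomposable module of `(s,t)`-type then `s < t → t = s+1` and `s > t → s = t+1`;
consequently every finite dimensional indecomposable module of Loewy length 2 is of
`(s,s)`-, `(s,s+1)`- or `(s+1,s)`-type for some `s ≥ 1`. -/
theorem statement15 (𝕜 : Type) [Field 𝕜] [IsAlgClosed 𝕜] (m n : ℕ) (hm : 1 < m) (hn : 1 < n)
    (ξ : 𝕜) (hξ : IsPrimitiveRoot ξ (m * n))
    (M : Type) [AddCommGroup M] [Module 𝕜 M] [Module (H 𝕜 m n ξ) M]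
    [IsScalarTower 𝕜 (H 𝕜 m n ξ) M] [FiniteDimensional 𝕜 M]
    (hindec : Indec 𝕜 m n ξ M) :
    (∀ s t : ℕ, IsType 𝕜 m n ξ M s t → (s < t → t = s + 1) ∧ (t < s → s = t + 1)) ∧
    (LoewyLen2 𝕜 m n ξ M → ∃ s : ℕ, 1 ≤ s ∧
      (IsType 𝕜 m n ξ M s s ∨ IsType 𝕜 m n ξ M s (s + 1) ∨ IsType 𝕜 m n ξ M (s + 1) s)) := by
  have := finite_H 𝕜 hm hn hξ
  have : IsArtinianRing (H 𝕜 m n ξ) := IsArtinianRing.of_finite 𝕜 _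
  have : IsNoetherian (H 𝕜 m n ξ) M := isNoetherian_of_tower 𝕜 inferInstance
  have : IsArtinian (H 𝕜 m n ξ) M := isArtinian_of_tower 𝕜 inferInstance
  obtain ⟨F, t, hD⟩ := exists_isDouble 𝕜 hm hn hξ
  have key : ∀ s t : ℕ, IsType 𝕜 m n ξ M s t → s ≤ t + 1 ∧ t ≤ s + 1 := by
    rintro s t ⟨hL, ht, hs⟩
    have := hindec.1
    have hle := hD.length_socle_le (gen_b_pow 𝕜 m n ξ) hindec.2
      (isSemisimpleModule_quotient_socle hL.2)
    have ht' := length_eq_of_lengthIs ht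
    have hs' := length_eq_of_lengthIs hs
    rw [socle] at ht' hs'
    rw [ht', hs'] at hle
    exact_mod_cast hle
  refine ⟨fun s t hst => ?_, fun hL => ?_⟩
  · have := key s t hst
    omega
  · obtain ⟨t, ht⟩ := exists_lengthIs (𝕜 := 𝕜) (m := m) (n := n) (ξ := ξ)
      (W := socle 𝕜 m n ξ M)
    obtain ⟨s, hs⟩ := exists_lengthIs (𝕜 := 𝕜) (m := m) (n := n) (ξ := ξ)
      (W := M ⧸ socle 𝕜 m n ξ M)
    have hst : IsType 𝕜 m n ξ M s t := ⟨hL, ht, hs⟩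
    have ht0 : t ≠ 0 := by
      rintro rfl
      have h0 := length_eq_of_lengthIs ht
      rw [Nat.cast_zero, Module.length_eq_zero_iff, Submodule.subsingleton_iff_eq_bot] at h0
      exact socle_ne_bot hL h0
    have hs0 : s ≠ 0 := by
      rintro rfl
      have h0 := length_eq_of_lengthIs hs
      rw [Nat.cast_zero, Module.length_eq_zero_iff, Submodule.Quotient.subsingleton_iff] at h0
      exact socle_ne_top hL h0
    obtain ⟨h1, h2⟩ := key s t hst
    obtain rfl | rfl | rfl : t = s ∨ t = s + 1 ∨ s = t + 1 := by omega
    · exact ⟨t, by omega, Or.inl hst⟩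
    · exact ⟨s, by omega, Or.inr (Or.inl hst)⟩
    · exact ⟨t, by omega, Or.inr (Or.inr hst)⟩

end Radford
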